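/- arXiv:1208.3075 — 6 statements merged into one kernel-verified Lean document; each statement's English description precedes it below -/
import Mathlib

section
/- Let G be a non-cyclic finitely generated free group and let φ be an injective but not surjective endomorphism of G. Then the descending HNN-extension G(φ) = ⟨G, t ; t⁻¹gt = gφ (g ∈ G)⟩ does not have the Howson property. -/
/-- A group has the Howson property if the intersection of any two finitely
generated subgroups is finitely generated. -/
def HowsonGroup (G : Type*) [Group G] : Prop :=
  ∀ H K : Subgroup G, H.FG → K.FG → (H ⊓ K).FG

/-- The descending HNN-extension `G(φ) = ⟨G, t ; t⁻¹ g t = gφ (g ∈ G)⟩` of a group `G`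
with respect to an injective endomorphism `φ`, realized as the Mathlib `HNNExtension`
with base `G`, associated subgroups `φ.range` and `G` (i.e. `⊤`), so that the relation
`t⁻¹ * of g * t = of (φ g)` holds for all `g : G`. -/
abbrev DescHNN {G : Type*} [Group G] (φ : G →* G) (hφ : Function.Injective φ) : Type _ :=
  HNNExtension G (MonoidHom.range φ) ⊤
    ((MonoidHom.ofInjective hφ).symm.trans Subgroup.topEquiv.symm)

namespace FreeGroup

/-- A finitely generated free group has a finite basis. -/
theorem finite_of_fg {S : Type*} (h : Group.FG (FreeGroup S)) : Finite S := by
  obtain ⟨T, hT⟩ := Group.fg_def.1 h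
  have hinj : Function.Injective
      fun (f : S → Multiplicative (ZMod 2)) (g : T) ↦ lift f (g : FreeGroup S) := by
    intro f f' hff
    refine (lift (α := S)).injective (MonoidHom.eq_of_eqOn_dense hT fun g hg ↦ ?_)
    exact congrFun hff ⟨g, hg⟩
  have := Finite.of_injective _ hinj
  classical
  refine Finite.of_injective (fun s : S ↦ (Pi.mulSingle s (Multiplicative.ofAdd 1) :
    S → Multiplicative (ZMod 2))) fun s s' h ↦ ?_
  by_contra hne
  have h1 := congrFun h s
  simp [Pi.mulSingle_eq_of_ne hne] at h1

/-- A finite index subgroup of a nonabelian free group of finite rank which has the same rank as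
the whole group is the whole group. -/
theorem eq_top_of_finiteIndex_of_mulEquiv {S : Type*} [Finite S] [Nontrivial S]
    (A : Subgroup (FreeGroup S)) [A.FiniteIndex] (e : A ≃* FreeGroup S) : A = ⊤ := by
  classical
  let F := FreeGroup S
  let Y := F ⧸ A
  let M := Multiplicative (ZMod 2)
  let o : Y := ((1 : F) : Y)
  let σ : Y → F := Quotient.out
  have hσ (y : Y) : σ y • o = y := by
    change ((σ y * 1 : F) : Y) = y
    rw [mul_one]
    exact Quotient.out_eq' y
  have hmem (s : S) (y : Y) : (σ y)⁻¹ * of s * σ ((of s)⁻¹ • y) ∈ A := by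
    have : ((σ y)⁻¹ * of s * σ ((of s)⁻¹ • y)) • o = o := by
      rw [mul_smul, hσ, mul_smul, smul_inv_smul, inv_smul_eq_iff, hσ]
    exact (SetLike.ext_iff.1 (MulAction.stabilizer_quotient A) _).1 this
  let ext (v : {y : Y // y ≠ o} → M) (y : Y) : M := if h : y ≠ o then v ⟨y, h⟩ else 1
  let R (p : (S → M) × ({y : Y // y ≠ o} → M)) (q : S × Y) : M :=
    lift p.1 (e ⟨_, hmem q.1 q.2⟩) * ext p.2 q.2 / ext p.2 ((of q.1)⁻¹ • q.2)
  let _ : MulDistribMulAction F (Y → M) := arrowMulDistribMulAction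
  have hR : Function.Surjective R := by
    intro c
    let Θ : F →* (Y → M) ⋊[MulDistribMulAction.toMulAut F (Y → M)] F :=
      lift fun s ↦ ⟨fun y ↦ c (s, y), of s⟩
    have hright (g : F) : (Θ g).right = g := by
      have : SemidirectProduct.rightHom.comp Θ = MonoidHom.id F := by
        ext s; simp [Θ, F]
      exact DFunLike.congr_fun this g
    have hmul (g h : F) (y : Y) : (Θ (g * h)).left y = (Θ g).left y * (Θ h).left (g⁻¹ • y) := by
      rw [_root_.map_mul, SemidirectProduct.mul_left, hright]
      rfl
    have hof (s : S) (y : Y) : (Θ (of s)).left y = c (s, y) := by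
      rw [lift_apply_of]
    have hstab (a : A) : (a : F)⁻¹ • o = o := by
      rw [← MulAction.mem_stabilizer_iff, MulAction.stabilizer_quotient A]
      exact A.inv_mem a.2
    let f : A →* M := MonoidHom.mk' (fun a ↦ (Θ a).left o) fun a b ↦ by
      rw [Subgroup.coe_mul, hmul, hstab]
    let v (y : Y) : M := (Θ (σ y)).left y / (Θ (σ o)).left o
    have hvo : v o = 1 := div_self' _
    refine ⟨(fun s ↦ f (e.symm (of s)), fun y ↦ v y), ?_⟩
    have hext (y : Y) : ext (fun y ↦ v y) y = v y := by
      by_cases h : y = o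
      · subst h; simp [ext, hvo]
      · simp [ext, h]
    have hlift (a : A) : lift (fun s ↦ f (e.symm (of s))) (e a) = f a := by
      have : lift (fun s ↦ f (e.symm (of s))) = f.comp e.symm.toMonoidHom := by
        ext s; simp
      rw [this]; simp
    funext ⟨s, y⟩
    simp only [R, hext, hlift]
    have h1 := hmul (of s) (σ ((of s)⁻¹ • y)) y
    have h2 := hmul (σ y) ((σ y)⁻¹ * of s * σ ((of s)⁻¹ • y)) y
    have h3 : (σ y)⁻¹ • y = o := by rw [inv_smul_eq_iff, hσ]
    rw [mul_assoc, mul_inv_cancel_left, h1, hof, h3] at h2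
    change (Θ ((σ y)⁻¹ * of s * σ ((of s)⁻¹ • y))).left o * v y / v ((of s)⁻¹ • y) = c (s, y)
    simp only [v]
    rw [mul_div_assoc, div_div_div_cancel_right, ← mul_div_assoc, div_eq_iff_eq_mul, h2, mul_comm,
      mul_assoc]
  have : Finite Y := inferInstanceAs (Finite (F ⧸ A))
  have hcard := Nat.card_le_card_of_surjective R hR
  have hM : Nat.card M = 2 := by simp [M]
  have hY : Nat.card {y : Y // y ≠ o} + 1 = Nat.card Y := by
    have := Fintype.ofFinite Y
    simp only [Nat.card_eq_fintype_card]
    rw [Fintype.card_subtype_compl, Fintype.card_subtype_eq]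
    exact Nat.sub_add_cancel (Fintype.card_pos_iff.2 ⟨o⟩)
  rw [Nat.card_prod, Nat.card_fun, Nat.card_fun, Nat.card_fun, hM, ← pow_add,
    Nat.card_prod, Nat.pow_le_pow_iff_right (by norm_num)] at hcard
  have hS : 1 < Nat.card S := Finite.one_lt_card
  rw [← Subgroup.index_eq_one]
  change Nat.card Y = 1
  have hpos : 0 < Nat.card Y := by omega
  by_contra hne
  have : 2 ≤ Nat.card Y := by omega
  nlinarith

/-- If `A` is a finitely generated subgroup of infinite index in a nonabelian free group, then
some nontrivial `x` satisfies `⟨K, x⟩ ⊓ A = K` for all subgroups `K` of `A`. -/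
theorem exists_sup_zpowers_inf_le {S : Type*} [Nontrivial S] {A : Subgroup (FreeGroup S)}
    (hfg : A.FG) (hA : ¬ A.FiniteIndex) :
    ∃ x : FreeGroup S, x ≠ 1 ∧ ∀ K ≤ A, (K ⊔ Subgroup.zpowers x) ⊓ A ≤ K := by
  classical
  obtain ⟨T, hT⟩ := hfg
  let L : Set (List (S × Bool)) := insert [] (⋃ w ∈ T, {l | l <:+ w.toWord})
  have hLfin : L.Finite := by
    refine Set.Finite.insert _ (T.finite_toSet.biUnion fun w _ ↦ ?_)
    exact (List.finite_toSet w.toWord.tails).subset fun l hl ↦ (List.mem_tails _ _).2 hl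
  have hLT (w : FreeGroup S) (hw : w ∈ T) : w.toWord ∈ L :=
    Or.inr (Set.mem_biUnion hw (List.suffix_refl _))
  have hLtail (c : S × Bool) (l : List (S × Bool)) (h : c :: l ∈ L) : l ∈ L := by
    rcases h with h | h
    · cases h
    · obtain ⟨w, hw, h⟩ := Set.mem_iUnion₂.1 h
      exact Or.inr (Set.mem_biUnion hw ((List.suffix_cons c l).trans h))
  let P : Set (FreeGroup S ⧸ A) := (fun l ↦ ((mk l : FreeGroup S) : FreeGroup S ⧸ A)) '' L
  have hcons (c : S × Bool) (l : List (S × Bool)) : mk (c :: l) = mk [c] * mk l := by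
    rw [mul_mk]; rfl
  have hexit : ∃ l ∈ L, ∃ c : S × Bool,
      ((mk (c :: l) : FreeGroup S) : FreeGroup S ⧸ A) ∉ P := by
    by_contra! hno
    have hall (l : List (S × Bool)) : ((mk l : FreeGroup S) : FreeGroup S ⧸ A) ∈ P := by
      induction l with
      | nil => exact ⟨[], Or.inl rfl, rfl⟩
      | cons c l ih =>
        obtain ⟨l', hl', h⟩ := ih
        have := hno l' hl' c
        rw [hcons] at this ⊢
        change mk [c] • ((mk l' : FreeGroup S) : FreeGroup S ⧸ A) ∈ P at this
        change mk [c] • ((mk l : FreeGroup S) : FreeGroup S ⧸ A) ∈ P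
        rwa [← h]
    have huniv : P = Set.univ := by
      refine Set.eq_univ_of_forall fun y ↦ ?_
      obtain ⟨g, rfl⟩ := QuotientGroup.mk_surjective y
      rw [← mk_toWord (x := g)]
      exact hall _
    have : Finite (FreeGroup S ⧸ A) := Set.finite_univ_iff.1 (huniv ▸ hLfin.image _)
    exact hA Subgroup.finiteIndex_of_finite_quotient
  obtain ⟨l₀, hl₀, c, hc⟩ := hexit
  obtain ⟨s, hs⟩ := exists_ne c.1
  let u : FreeGroup S := mk (c :: l₀)
  refine ⟨u⁻¹ * of s * u, ?_, fun K hK ↦ ?_⟩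
  · intro h
    refine of_ne_one s ?_
    have : of s = u * (u⁻¹ * of s * u) * u⁻¹ := by group
    rw [this, h]; group
  let Z := FreeGroup S ⧸ K
  let v : Z := (u : Z)
  have hv (g : FreeGroup S) (hg : (g : FreeGroup S ⧸ A) ∈ P) : (g : Z) ≠ v := by
    intro h
    have := congrArg (Subgroup.quotientMapOfLE hK) h
    simp only [v, Subgroup.quotientMapOfLE_apply_mk] at this
    exact hc (this ▸ hg)
  let τ (i : S) : Equiv.Perm Z :=
    if i = s then Equiv.swap v (of s • v) * MulAction.toPerm (of s) else MulAction.toPerm (of i)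
  let θ : FreeGroup S →* Equiv.Perm Z := lift τ
  have hof (i : S) (z : Z) (h1 : z ≠ v) (h2 : of i • z ≠ v) : θ (of i) z = of i • z := by
    by_cases hi : i = s
    · subst hi
      simp only [θ, lift_apply_of, τ, if_true, Equiv.Perm.mul_apply, MulAction.toPerm_apply]
      exact Equiv.swap_apply_of_ne_of_ne h2 fun h ↦ h1 (MulAction.injective _ h)
    · simp [θ, τ, hi]
  have hletter (d : S × Bool) (z : Z) (h1 : z ≠ v) (h2 : mk [d] • z ≠ v) :
      θ (mk [d]) z = mk [d] • z := by
    obtain ⟨i, _ | _⟩ := d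
    · have hinv : (mk [(i, false)] : FreeGroup S) = (of i)⁻¹ := rfl
      rw [hinv] at h2 ⊢
      rw [_root_.map_inv, Equiv.Perm.inv_eq_iff_eq, hof i _ h2 (by rwa [smul_inv_smul]),
        smul_inv_smul]
    · exact hof i z h1 h2
  have hword (l : List (S × Bool)) (hl : l ∈ L) (b : FreeGroup S) (hb : b ∈ A) :
      θ (mk l) (b : Z) = ((mk l * b : FreeGroup S) : Z) := by
    have hP (l : List (S × Bool)) (hl : l ∈ L) :
        ((mk l * b : FreeGroup S) : FreeGroup S ⧸ A) ∈ P :=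
      ⟨l, hl, QuotientGroup.eq.2 (by rwa [inv_mul_cancel_left])⟩
    induction l with
    | nil => rw [← one_eq_mk, _root_.map_one, one_mul]; rfl
    | cons d l ih =>
      have h := hLtail d l hl
      have h1 := hv _ (hP l h)
      have h2 := hv _ (hP _ hl)
      rw [hcons, mul_assoc] at h2
      rw [hcons, _root_.map_mul, Equiv.Perm.mul_apply, ih h, hletter d _ h1 h2, mul_assoc]
      rfl
  have hact (a : FreeGroup S) (ha : a ∈ A) : ∀ b ∈ A,
      θ a (b : Z) = ((a * b : FreeGroup S) : Z) := by
    rw [← hT] at ha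
    induction ha using Subgroup.closure_induction with
    | mem w hw =>
      intro b hb
      have := hword _ (hLT w hw) b hb
      rwa [mk_toWord] at this
    | one => simp
    | mul x y hx hy ihx ihy =>
      intro b hb
      rw [_root_.map_mul, Equiv.Perm.mul_apply, ihy b hb, ihx _ (A.mul_mem (hT ▸ hy) hb), mul_assoc]
    | inv x hx ih =>
      intro b hb
      rw [_root_.map_inv, Equiv.Perm.inv_eq_iff_eq, ih _ (A.mul_mem (A.inv_mem (hT ▸ hx)) hb),
        mul_inv_cancel_left]
  let o : Z := ((1 : FreeGroup S) : Z)
  have hu : θ u o = v := by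
    have hcu : θ (mk [c]) = MulAction.toPerm (mk [c]) := by
      obtain ⟨i, _ | _⟩ := c
      · have hinv : (mk [(i, false)] : FreeGroup S) = (of i)⁻¹ := rfl
        rw [hinv, _root_.map_inv]
        simp [θ, τ, hs.symm]
        rfl
      · change θ (of i) = MulAction.toPerm (of i)
        simp [θ, τ, hs.symm]
    simp only [u, v, o]
    rw [hcons, _root_.map_mul, Equiv.Perm.mul_apply, hword l₀ hl₀ 1 A.one_mem, hcu, mul_one]
    rfl
  have hsv : θ (of s) v = v := by simp [θ, τ]
  have hle : K ⊔ Subgroup.zpowers (u⁻¹ * of s * u) ≤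
      (MulAction.stabilizer (Equiv.Perm Z) o).comap θ := by
    refine sup_le (fun k hk ↦ ?_) ((Subgroup.zpowers_le).2 ?_)
    · change θ k o = o
      rw [hact k (hK hk) 1 A.one_mem]
      exact QuotientGroup.eq.2 (by simpa using hk)
    · change θ (u⁻¹ * of s * u) o = o
      rw [_root_.map_mul, _root_.map_mul, _root_.map_inv, Equiv.Perm.mul_apply,
        Equiv.Perm.mul_apply, hu, hsv, Equiv.Perm.inv_eq_iff_eq, hu]
  rintro g ⟨hg, hgA⟩
  have h : θ g o = o := hle hg
  rw [hact g hgA 1 A.one_mem, mul_one] at h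
  simpa using QuotientGroup.eq.1 h

end FreeGroup

/-- The orbit of `x` under `φ` does not satisfy the condition that some `φ^[m] x` lies in the
subgroup generated by the previous iterates, as soon as `⟨K, x⟩ ⊓ φ.range = K` for all `K` below
the range of the injective endomorphism `φ`. -/
theorem iterate_notMem_closure {G : Type*} [Group G] {φ : G →* G} (hφ : Function.Injective φ)
    {x : G} (hx : x ≠ 1)
    (h : ∀ K ≤ φ.range, (K ⊔ Subgroup.zpowers x) ⊓ φ.range ≤ K) (m : ℕ) :
    φ^[m] x ∉ Subgroup.closure ((φ^[·] x) '' Set.Iio m) := by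
  induction m with
  | zero => simpa using hx
  | succ m ih =>
    intro hm
    let K := (Subgroup.closure ((φ^[·] x) '' Set.Iio m)).map φ
    have hle : Subgroup.closure ((φ^[·] x) '' Set.Iio (m + 1)) ≤ K ⊔ Subgroup.zpowers x := by
      rw [Subgroup.closure_le]
      rintro _ ⟨i, hi, rfl⟩
      rcases i with _ | i
      · exact le_sup_right (a := K) (Subgroup.mem_zpowers x)
      · refine le_sup_left (a := K) ⟨φ^[i] x, Subgroup.subset_closure ⟨i, ?_, rfl⟩, ?_⟩
        · exact Nat.lt_of_succ_lt_succ hi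
        · exact (Function.iterate_succ_apply' φ i x).symm
    obtain ⟨y, hy, hyx⟩ := h K (Subgroup.map_le_range φ _)
      ⟨hle hm, φ^[m] x, (Function.iterate_succ_apply' φ m x).symm⟩
    rw [Function.iterate_succ_apply'] at hyx
    exact ih (hφ hyx ▸ hy)

/-- A non-surjective injective endomorphism `φ` of a nonabelian free group of finite rank admits
a nontrivial element `x` with `⟨K, x⟩ ⊓ φ.range = K` for all `K` below the range of `φ`. -/
theorem exists_sup_zpowers_inf_range_le {G : Type*} [Group G] [IsFreeGroup G] [Group.FG G]
    (hnc : ¬ IsCyclic G) {φ : G →* G} (hφ : Function.Injective φ)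
    (hns : ¬ Function.Surjective φ) :
    ∃ x : G, x ≠ 1 ∧ ∀ K ≤ φ.range, (K ⊔ Subgroup.zpowers x) ⊓ φ.range ≤ K := by
  let e := IsFreeGroup.toFreeGroup G
  have : Finite (IsFreeGroup.Generators G) :=
    FreeGroup.finite_of_fg (Group.fg_of_surjective (f := e.toMonoidHom) e.surjective)
  have : Nontrivial (IsFreeGroup.Generators G) := by
    by_contra hS
    rw [not_nontrivial_iff_subsingleton] at hS
    refine hnc ?_
    have : IsCyclic (FreeGroup (IsFreeGroup.Generators G)) := by
      rcases isEmpty_or_nonempty (IsFreeGroup.Generators G) with h | ⟨⟨s⟩⟩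
      · infer_instance
      · let _ : Unique (IsFreeGroup.Generators G) := uniqueOfSubsingleton s
        infer_instance
    exact isCyclic_of_surjective e.symm e.symm.surjective
  let A := φ.range.map e.toMonoidHom
  have hA : ¬ A.FiniteIndex := by
    intro hfin
    have htop := FreeGroup.eq_top_of_finiteIndex_of_mulEquiv A
      (((e.subgroupMap φ.range).symm.trans (MonoidHom.ofInjective hφ).symm).trans e)
    refine hns fun g ↦ ?_
    obtain ⟨_, ⟨y, rfl⟩, hy⟩ : e g ∈ A := htop ▸ Subgroup.mem_top _
    exact ⟨y, e.injective hy⟩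
  have hfg : A.FG := by
    rw [← Group.fg_iff_subgroup_fg]
    exact Group.fg_of_surjective (f := (((MonoidHom.ofInjective hφ).trans
      (e.subgroupMap φ.range)).toMonoidHom)) (MulEquiv.surjective _)
  obtain ⟨x, hx, h⟩ := FreeGroup.exists_sup_zpowers_inf_le hfg hA
  refine ⟨e.symm x, by simpa using hx, fun K hK g hg ↦ ?_⟩
  have hmem := h (K.map e.toMonoidHom) (Subgroup.map_mono hK)
    (x := e g) ⟨?_, Subgroup.mem_map_of_mem e.toMonoidHom hg.2⟩
  · obtain ⟨k, hk, hkg⟩ := hmem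
    exact e.injective hkg ▸ hk
  · have := Subgroup.mem_map_of_mem e.toMonoidHom hg.1
    rw [Subgroup.map_sup, MonoidHom.map_zpowers] at this
    simpa using this

namespace DescHNN

open HNNExtension

variable {G : Type*} [Group G] {φ : G →* G} {hφ : Function.Injective φ}

theorem inv_t_mul_of_mul_t (g : G) :
    (t⁻¹ * of g * t : DescHNN φ hφ) = of (φ g) := by
  have := equiv_symm_eq_conj (φ := (MonoidHom.ofInjective hφ).symm.trans Subgroup.topEquiv.symm)
    ⟨g, Subgroup.mem_top g⟩
  exact this.symm

theorem pow_conj_of (k : ℕ) (g : G) :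
    ((t ^ k)⁻¹ * of g * t ^ k : DescHNN φ hφ) = of (φ^[k] g) := by
  induction k with
  | zero => simp
  | succ k ih =>
    rw [Function.iterate_succ_apply', ← inv_t_mul_of_mul_t, ← ih, pow_succ]
    group

/-- The elements `h` such that `t ^ (-k) * h * t ^ k` lies in the subgroup of the base group
generated by the first `2 * k + 1` iterates of `x` under `φ`. -/
noncomputable def orbitLevel (hφ : Function.Injective φ) (x : G) (k : ℕ) : Subgroup (DescHNN φ hφ) :=
  ((Subgroup.closure ((φ^[·] x) '' Set.Iio (2 * k + 1))).map of).comap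
    (MulAut.conj (t ^ k)⁻¹).toMonoidHom

theorem mem_orbitLevel {x : G} {k : ℕ} {h : DescHNN φ hφ} :
    h ∈ orbitLevel hφ x k ↔ ∃ g ∈ Subgroup.closure ((φ^[·] x) '' Set.Iio (2 * k + 1)),
      of g = (t ^ k)⁻¹ * h * t ^ k := by
  simp only [orbitLevel, Subgroup.mem_comap, Subgroup.mem_map, MulEquiv.toMonoidHom_eq_coe,
    MonoidHom.coe_coe, MulAut.conj_apply, inv_inv]

theorem iterate_mem_closure {x g : G} {m : ℕ} (j : ℕ)
    (hg : g ∈ Subgroup.closure ((φ^[·] x) '' Set.Iio m)) {n : ℕ} (hn : m + j ≤ n) :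
    φ^[j] g ∈ Subgroup.closure ((φ^[·] x) '' Set.Iio n) := by
  induction hg using Subgroup.closure_induction with
  | mem y hy =>
    obtain ⟨i, hi, rfl⟩ := hy
    refine Subgroup.subset_closure ⟨j + i, ?_, Function.iterate_add_apply φ j i x⟩
    simp only [Set.mem_Iio] at hi ⊢
    omega
  | one => simp only [iterate_map_one, one_mem]
  | mul y z _ _ hy hz => simpa only [iterate_map_mul] using mul_mem hy hz
  | inv y _ hy => simpa only [iterate_map_inv] using inv_mem hy

theorem orbitLevel_mono (x : G) : Monotone (orbitLevel hφ x) := by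
  refine monotone_nat_of_le_succ fun k h hh ↦ ?_
  obtain ⟨g, hg, hgh⟩ := mem_orbitLevel.1 hh
  refine mem_orbitLevel.2 ⟨φ^[1] g, iterate_mem_closure 1 hg (by omega), ?_⟩
  rw [← pow_conj_of, hgh]
  group

theorem of_mem_orbitLevel (x : G) : of x ∈ orbitLevel hφ x 0 :=
  mem_orbitLevel.2 ⟨x, Subgroup.subset_closure ⟨0, by simp⟩, by simp⟩

theorem inv_t_mul_mem_orbitLevel {x : G} {k : ℕ} {h : DescHNN φ hφ} (hh : h ∈ orbitLevel hφ x k) :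
    t⁻¹ * h * t ∈ orbitLevel hφ x (k + 1) := by
  obtain ⟨g, hg, hgh⟩ := mem_orbitLevel.1 hh
  refine mem_orbitLevel.2 ⟨φ^[2] g, iterate_mem_closure 2 hg (by omega), ?_⟩
  rw [← pow_conj_of, hgh]
  group

theorem t_mul_mem_orbitLevel {x : G} {k : ℕ} {h : DescHNN φ hφ} (hh : h ∈ orbitLevel hφ x k) :
    t * h * t⁻¹ ∈ orbitLevel hφ x (k + 1) := by
  obtain ⟨g, hg, hgh⟩ := mem_orbitLevel.1 hh
  refine mem_orbitLevel.2 ⟨g, iterate_mem_closure 0 hg (by omega), ?_⟩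
  rw [hgh]
  group

theorem mem_iSup_orbitLevel {x : G} {h : DescHNN φ hφ} :
    h ∈ ⨆ k, orbitLevel hφ x k ↔ ∃ k, h ∈ orbitLevel hφ x k :=
  Subgroup.mem_iSup_of_directed (orbitLevel_mono x).directed_le

theorem zpow_conj_mem_iSup_orbitLevel {x : G} {h : DescHNN φ hφ}
    (hh : h ∈ ⨆ k, orbitLevel hφ x k) (n : ℤ) :
    t ^ n * h * (t ^ n)⁻¹ ∈ ⨆ k, orbitLevel hφ x k := by
  induction n with
  | zero => simpa
  | succ n ih =>
    obtain ⟨k, hk⟩ := mem_iSup_orbitLevel.1 ih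
    refine mem_iSup_orbitLevel.2 ⟨k + 1, ?_⟩
    convert t_mul_mem_orbitLevel hk using 1
    group
  | pred n ih =>
    obtain ⟨k, hk⟩ := mem_iSup_orbitLevel.1 ih
    refine mem_iSup_orbitLevel.2 ⟨k + 1, ?_⟩
    convert inv_t_mul_mem_orbitLevel hk using 1
    group

/-- The exponent sum of the stable letter. -/
noncomputable def exponentSum (hφ : Function.Injective φ) : DescHNN φ hφ →* Multiplicative ℤ :=
  lift 1 (Multiplicative.ofAdd 1) (by simp)

theorem exists_mul_zpow_of_mem_closure {x : G} {h : DescHNN φ hφ}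
    (hh : h ∈ Subgroup.closure {of x, t}) :
    ∃ y ∈ ⨆ k, orbitLevel hφ x k, ∃ n : ℤ, h = y * t ^ n := by
  induction hh using Subgroup.closure_induction with
  | mem h hh =>
    rcases hh with rfl | rfl
    · exact ⟨of x, mem_iSup_orbitLevel.2 ⟨0, of_mem_orbitLevel x⟩, 0, by simp⟩
    · exact ⟨1, one_mem _, 1, by simp⟩
  | one => exact ⟨1, one_mem _, 0, by simp⟩
  | mul a b _ _ iha ihb =>
    obtain ⟨y, hy, n, rfl⟩ := iha
    obtain ⟨z, hz, m, rfl⟩ := ihb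
    exact ⟨_, mul_mem hy (zpow_conj_mem_iSup_orbitLevel hz n), n + m, by group⟩
  | inv a _ iha =>
    obtain ⟨y, hy, n, rfl⟩ := iha
    exact ⟨_, zpow_conj_mem_iSup_orbitLevel (inv_mem hy) (-n), -n, by group⟩

theorem closure_inf_range_le (x : G) :
    Subgroup.closure {of x, t} ⊓ (of : G →* DescHNN φ hφ).range ≤ ⨆ k, orbitLevel hφ x k := by
  rintro _ ⟨hh, g, rfl⟩
  obtain ⟨y, hy, n, hyn⟩ := exists_mul_zpow_of_mem_closure hh
  have hker : (⨆ k, orbitLevel hφ x k) ≤ (exponentSum hφ).ker := by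
    refine iSup_le fun k h hk ↦ ?_
    obtain ⟨g, -, hg⟩ := mem_orbitLevel.1 hk
    have := congrArg (exponentSum hφ) hg
    simpa [exponentSum] using this.symm
  have hn := congrArg (exponentSum hφ) hyn
  rw [map_mul, hker hy, map_zpow, one_mul] at hn
  have hn0 : n = 0 := by
    have h1 : 1 = Multiplicative.ofAdd n := by simpa [exponentSum, ← ofAdd_zsmul] using hn
    exact (Multiplicative.ofAdd.injective h1).symm
  simpa [hyn, hn0] using hy

/-- If every finitely generated part of the `φ`-orbit of `x` fails to generate the next iterate,
then the intersection of `⟨x, t⟩` with the base group is not finitely generated. -/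
theorem not_fg_closure_inf_range {x : G}
    (hx : ∀ m, φ^[m] x ∉ Subgroup.closure ((φ^[·] x) '' Set.Iio m)) :
    ¬ (Subgroup.closure {of x, t} ⊓ (of : G →* DescHNN φ hφ).range).FG := by
  rintro ⟨T, hT⟩
  have hk : ∃ k, ∀ h ∈ T, h ∈ orbitLevel hφ x k := by
    have hT' (h : T) : ∃ k, (h : DescHNN φ hφ) ∈ orbitLevel hφ x k :=
      mem_iSup_orbitLevel.1 (closure_inf_range_le x (hT ▸ Subgroup.subset_closure h.2))
    choose k hk using hT'
    obtain ⟨N, hN⟩ := (Set.finite_range k).bddAbove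
    exact ⟨N, fun h hh ↦ orbitLevel_mono x (hN ⟨⟨h, hh⟩, rfl⟩) (hk ⟨h, hh⟩)⟩
  obtain ⟨k, hk⟩ := hk
  have hle : Subgroup.closure {of x, t} ⊓ (of : G →* DescHNN φ hφ).range ≤ orbitLevel hφ x k := by
    rw [← hT, Subgroup.closure_le]
    exact hk
  have hmem : of (φ^[k + 1] x) ∈
      Subgroup.closure {of x, t} ⊓ (of : G →* DescHNN φ hφ).range := by
    refine ⟨?_, _, rfl⟩
    have ht : (t : DescHNN φ hφ) ∈ Subgroup.closure {of x, t} :=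
      Subgroup.subset_closure (by simp)
    rw [← pow_conj_of]
    exact Subgroup.mul_mem _ (Subgroup.mul_mem _ (Subgroup.inv_mem _ (pow_mem ht _))
      (Subgroup.subset_closure (by simp))) (pow_mem ht _)
  obtain ⟨g, hg, hgh⟩ := mem_orbitLevel.1 (hle hmem)
  rw [pow_conj_of, ← Function.iterate_add_apply] at hgh
  have := of_injective _ hgh
  subst this
  rw [show 2 * k + 1 = k + (k + 1) by omega] at hg
  exact hx _ hg

end DescHNN

/-- **Theorem 1.** If `G` is a non-cyclic finitely generated free group and `φ` is an
injective but not surjective endomorphism of `G`, then the descending HNN-extension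
`G(φ)` does not have the Howson property. -/
theorem descHNN_of_free_not_howson {G : Type*} [Group G] [IsFreeGroup G] [Group.FG G]
    (hnc : ¬ IsCyclic G) (φ : G →* G) (hφ : Function.Injective φ)
    (hns : ¬ Function.Surjective φ) :
    ¬ HowsonGroup (DescHNN φ hφ) := by
  intro hH
  obtain ⟨x, hx, h⟩ := exists_sup_zpowers_inf_range_le hnc hφ hns
  refine DescHNN.not_fg_closure_inf_range (hφ := hφ) (iterate_notMem_closure hφ hx h)
    (hH _ _ ((Subgroup.fg_iff _).2 ⟨_, rfl, Set.toFinite _⟩) ?_)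
  rw [← Group.fg_iff_subgroup_fg]
  exact Group.fg_range _
end

section
/- Let G be a finitely generated group, let φ be an injective but not surjective endomorphism of G, and set H = Gφ. If the subgroup H of G is freely complemented, then the descending HNN-extension G(φ) = ⟨G, t ; t⁻¹gt = gφ (g ∈ G)⟩ does not have the Howson property. -/
/-- The subgroup generated by subgroups `H` and `K` of a group `G` is their internal
free product `H ∗ K`: the canonical homomorphism from the abstract free product
`H ∗ K` to `G` (whose range is `⟨H, K⟩ = H ⊔ K`) is injective. -/
def IsInternalFreeProductPair {G : Type*} [Group G] (H K : Subgroup G) : Prop :=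
  Function.Injective (Monoid.Coprod.lift H.subtype K.subtype)

/-- A subgroup `H` of a group `G` is freely complemented if there is a non-identity
subgroup `K` of `G` such that the subgroup generated by `H` and `K` is their
internal free product `H ∗ K`. -/
def FreelyComplemented {G : Type*} [Group G] (H : Subgroup G) : Prop :=
  ∃ K : Subgroup G, K ≠ ⊥ ∧ IsInternalFreeProductPair H K

/-- If the range of `φ` has a free complement containing `k`, then adjoining `k` to the image
of a subgroup `Q` does not enlarge the intersection with the range of `φ`. -/
lemma mem_of_map_mem_map_sup_zpowers {G : Type*} [Group G] {φ : G →* G}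
    (hφ : Function.Injective φ) {K : Subgroup G} (hK : IsInternalFreeProductPair φ.range K)
    {k : G} (hk : k ∈ K) {Q : Subgroup G} {g : G}
    (hg : φ g ∈ Q.map φ ⊔ Subgroup.zpowers k) : g ∈ Q := by
  have hle : Q.map φ ⊔ Subgroup.zpowers k ≤
      ((Q.map φ).comap (φ.range.subtype.comp Monoid.Coprod.fst)).map
        (Monoid.Coprod.lift φ.range.subtype K.subtype) := by
    refine sup_le ?_ (Subgroup.zpowers_le.2 ?_)
    · rintro _ ⟨q, hq, rfl⟩
      exact ⟨Monoid.Coprod.inl ⟨φ q, q, rfl⟩, ⟨q, hq, by simp⟩, by simp⟩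
    · exact ⟨Monoid.Coprod.inr ⟨k, hk⟩, ⟨1, Q.one_mem, by simp⟩, by simp⟩
  obtain ⟨y, ⟨q, hq, hqy⟩, hy⟩ := hle hg
  have hyg : y = Monoid.Coprod.inl ⟨φ g, g, rfl⟩ := hK (by simpa using hy)
  subst hyg
  have : q = g := hφ (by simpa using hqy)
  exact this ▸ hq

/-- The subgroup generated by `k, φ k, …, φ^(n-1) k`. -/
def orbitSubgroup {G : Type*} [Group G] (φ : G →* G) (k : G) : ℕ → Subgroup G
  | 0 => ⊥
  | n + 1 => (orbitSubgroup φ k n).map φ ⊔ Subgroup.zpowers k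

section orbitSubgroup

variable {G : Type*} [Group G] (φ : G →* G) (k : G)

lemma monotone_orbitSubgroup : Monotone (orbitSubgroup φ k) := by
  refine monotone_nat_of_le_succ fun n => ?_
  induction n with
  | zero => exact bot_le
  | succ n ih => exact sup_le_sup_right (Subgroup.map_mono ih) _

lemma iterate_mem_orbitSubgroup (n : ℕ) : φ^[n] k ∈ orbitSubgroup φ k (n + 1) := by
  induction n with
  | zero => exact Subgroup.mem_sup_right (Subgroup.mem_zpowers k)
  | succ n ih =>
    rw [Function.iterate_succ_apply']
    exact Subgroup.mem_sup_left (Subgroup.mem_map_of_mem φ ih)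

lemma mem_iSup_orbitSubgroup {g : G} :
    g ∈ ⨆ n, orbitSubgroup φ k n ↔ ∃ n, g ∈ orbitSubgroup φ k n :=
  Subgroup.mem_iSup_of_directed (monotone_orbitSubgroup φ k).directed_le

lemma map_mem_iSup_orbitSubgroup {g : G} (hg : g ∈ ⨆ n, orbitSubgroup φ k n) :
    φ g ∈ ⨆ n, orbitSubgroup φ k n := by
  rw [mem_iSup_orbitSubgroup] at hg ⊢
  obtain ⟨n, hn⟩ := hg
  exact ⟨n + 1, Subgroup.mem_sup_left (Subgroup.mem_map_of_mem φ hn)⟩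

lemma iterate_mem_iSup_orbitSubgroup {g : G} (hg : g ∈ ⨆ n, orbitSubgroup φ k n) (i : ℕ) :
    φ^[i] g ∈ ⨆ n, orbitSubgroup φ k n := by
  induction i with
  | zero => exact hg
  | succ i ih =>
    rw [Function.iterate_succ_apply']
    exact map_mem_iSup_orbitSubgroup φ k ih

variable {φ k} {K : Subgroup G}

lemma mem_iSup_orbitSubgroup_of_iterate_mem (hφ : Function.Injective φ)
    (hK : IsInternalFreeProductPair φ.range K) (hk : k ∈ K) (i : ℕ) {g : G}
    (hg : φ^[i] g ∈ ⨆ n, orbitSubgroup φ k n) : g ∈ ⨆ n, orbitSubgroup φ k n := by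
  induction i with
  | zero => exact hg
  | succ i ih =>
    rw [Function.iterate_succ_apply'] at hg
    obtain ⟨n, hn⟩ := (mem_iSup_orbitSubgroup φ k).1 hg
    exact ih ((mem_iSup_orbitSubgroup φ k).2
      ⟨n, mem_of_map_mem_map_sup_zpowers hφ hK hk (monotone_orbitSubgroup φ k n.le_succ hn)⟩)

lemma eq_one_of_iterate_mem_orbitSubgroup (hφ : Function.Injective φ)
    (hK : IsInternalFreeProductPair φ.range K) (hk : k ∈ K) {n : ℕ} {g : G}
    (hg : φ^[n] g ∈ orbitSubgroup φ k n) : g = 1 := by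
  induction n with
  | zero => exact Subgroup.mem_bot.1 hg
  | succ n ih =>
    rw [Function.iterate_succ_apply'] at hg
    exact ih (mem_of_map_mem_map_sup_zpowers hφ hK hk hg)

lemma not_fg_iSup_orbitSubgroup (hφ : Function.Injective φ)
    (hK : IsInternalFreeProductPair φ.range K) (hk : k ∈ K) (hk1 : k ≠ 1) :
    ¬ (⨆ n, orbitSubgroup φ k n).FG := by
  rintro ⟨S, hS⟩
  have hmem : ∀ s ∈ S, ∃ n, s ∈ orbitSubgroup φ k n := fun s hs =>
    (mem_iSup_orbitSubgroup φ k).1 (hS ▸ Subgroup.subset_closure hs)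
  choose! f hf using hmem
  have hle : ⨆ n, orbitSubgroup φ k n ≤ orbitSubgroup φ k (S.sup f) := by
    rw [← hS, Subgroup.closure_le]
    exact fun s hs => monotone_orbitSubgroup φ k (Finset.le_sup hs) (hf s hs)
  exact hk1 (eq_one_of_iterate_mem_orbitSubgroup hφ hK hk
    (hle ((mem_iSup_orbitSubgroup φ k).2 ⟨_, iterate_mem_orbitSubgroup φ k _⟩)))

end orbitSubgroup

namespace DescHNN

variable {G : Type*} [Group G] {φ : G →* G} (hφ : Function.Injective φ)

/-- The base group of the descending HNN-extension. -/
noncomputable abbrev ofBase : G →* DescHNN φ hφ := HNNExtension.of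

/-- The stable letter of the descending HNN-extension. -/
noncomputable abbrev stable : DescHNN φ hφ := HNNExtension.t

lemma ofBase_mul_stable (g : G) :
    ofBase hφ g * stable hφ = stable hφ * ofBase hφ (φ g) := by
  have h := HNNExtension.t_mul_of (φ := (MonoidHom.ofInjective hφ).symm.trans
    Subgroup.topEquiv.symm) (MonoidHom.ofInjective hφ g)
  rw [MulEquiv.trans_apply, MulEquiv.symm_apply_apply] at h
  exact h.symm

lemma ofBase_mul_stable_pow (g : G) (i : ℕ) :
    ofBase hφ g * stable hφ ^ i = stable hφ ^ i * ofBase hφ (φ^[i] g) := by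
  induction i with
  | zero => simp
  | succ i ih =>
    rw [pow_succ, ← mul_assoc, ih, mul_assoc, ofBase_mul_stable, ← mul_assoc,
      Function.iterate_succ_apply']

lemma stable_pow_inv_mul_ofBase (g : G) (i : ℕ) :
    (stable hφ ^ i)⁻¹ * ofBase hφ g = ofBase hφ (φ^[i] g) * (stable hφ ^ i)⁻¹ := by
  rw [inv_mul_eq_iff_eq_mul, ← mul_assoc, ← ofBase_mul_stable_pow, mul_inv_cancel_right]

/-- The homomorphism to `ℤ` that kills the base group and sends the stable letter to `1`. -/
noncomputable def exponent : DescHNN φ hφ →* Multiplicative ℤ :=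
  HNNExtension.lift 1 (Multiplicative.ofAdd 1) (by simp)

lemma exponent_ofBase (g : G) : exponent hφ (ofBase hφ g) = 1 := by
  simp [exponent]

lemma exponent_stable_pow (i : ℕ) :
    exponent hφ (stable hφ ^ i) = Multiplicative.ofAdd (i : ℤ) := by
  simp [exponent, ← ofAdd_nsmul]

lemma exists_eq_of_mem_closure {P : Subgroup G} (hP : ∀ g ∈ P, φ g ∈ P) {k : G} (hk : k ∈ P)
    {x : DescHNN φ hφ} (hx : x ∈ Subgroup.closure {ofBase hφ k, stable hφ}) :
    ∃ i j : ℕ, ∃ p ∈ P, x = stable hφ ^ i * ofBase hφ p * (stable hφ ^ j)⁻¹ := by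
  have hPi : ∀ (i : ℕ), ∀ g ∈ P, φ^[i] g ∈ P := fun i g hg => by
    induction i with
    | zero => exact hg
    | succ i ih =>
      rw [Function.iterate_succ_apply']
      exact hP _ ih
  induction hx using Subgroup.closure_induction with
  | mem x hx =>
    rcases hx with rfl | rfl
    · exact ⟨0, 0, k, hk, by simp⟩
    · exact ⟨1, 0, 1, P.one_mem, by simp⟩
  | one => exact ⟨0, 0, 1, P.one_mem, by simp⟩
  | inv x _ ih =>
    obtain ⟨i, j, p, hp, rfl⟩ := ih
    exact ⟨j, i, p⁻¹, P.inv_mem hp, by simp [mul_assoc]⟩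
  | mul x y _ _ ihx ihy =>
    obtain ⟨i, j, p, hp, rfl⟩ := ihx
    obtain ⟨i', j', p', hp', rfl⟩ := ihy
    rcases le_total j i' with h | h
    · obtain ⟨d, rfl⟩ := Nat.exists_eq_add_of_le h
      refine ⟨i + d, j', φ^[d] p * p', P.mul_mem (hPi d p hp) hp', ?_⟩
      calc _ = stable hφ ^ i * (ofBase hφ p * stable hφ ^ d) * ofBase hφ p' *
            (stable hφ ^ j')⁻¹ := by rw [pow_add]; group
        _ = _ := by rw [ofBase_mul_stable_pow, map_mul, pow_add]; group
    · obtain ⟨d, rfl⟩ := Nat.exists_eq_add_of_le h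
      refine ⟨i, j' + d, p * φ^[d] p', P.mul_mem hp (hPi d p' hp'), ?_⟩
      calc _ = stable hφ ^ i * ofBase hφ p * ((stable hφ ^ d)⁻¹ * ofBase hφ p') *
            (stable hφ ^ j')⁻¹ := by rw [pow_add]; group
        _ = _ := by rw [stable_pow_inv_mul_ofBase, map_mul, pow_add]; group

lemma exists_iterate_mem_of_ofBase_mem_closure {P : Subgroup G} (hP : ∀ g ∈ P, φ g ∈ P) {k : G}
    (hk : k ∈ P) {g : G}
    (hg : ofBase hφ g ∈ Subgroup.closure {ofBase hφ k, stable hφ}) : ∃ i, φ^[i] g ∈ P := by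
  obtain ⟨i, j, p, hp, h⟩ := exists_eq_of_mem_closure hφ hP hk hg
  have hij : i = j := by
    have := congrArg (exponent hφ) h
    rw [map_mul, map_mul, map_inv, exponent_ofBase, exponent_ofBase, exponent_stable_pow,
      exponent_stable_pow, mul_one, eq_mul_inv_iff_mul_eq, one_mul] at this
    exact_mod_cast (Multiplicative.ofAdd.injective this).symm
  subst hij
  rw [eq_mul_inv_iff_mul_eq, ofBase_mul_stable_pow] at h
  have := HNNExtension.of_injective _ (mul_left_cancel h)
  exact ⟨i, this ▸ hp⟩

lemma map_orbitSubgroup_le_closure (k : G) (n : ℕ) :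
    (orbitSubgroup φ k n).map (ofBase hφ) ≤
      Subgroup.closure {ofBase hφ k, stable hφ} := by
  have ht : stable hφ ∈ Subgroup.closure {ofBase hφ k, stable hφ} :=
    Subgroup.subset_closure (by simp)
  induction n with
  | zero => simp [orbitSubgroup]
  | succ n ih =>
    rw [orbitSubgroup, Subgroup.map_sup, sup_le_iff, Subgroup.map_le_iff_le_comap,
      Subgroup.map_le_iff_le_comap, Subgroup.map_le_iff_le_comap, Subgroup.zpowers_le]
    refine ⟨fun g hg => ?_, Subgroup.subset_closure (by simp)⟩
    have hconj : ofBase hφ (φ g) = (stable hφ)⁻¹ * (ofBase hφ g * stable hφ) := by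
      rw [ofBase_mul_stable, inv_mul_cancel_left]
    rw [Subgroup.mem_comap, Subgroup.mem_comap, hconj]
    exact mul_mem (inv_mem ht) (mul_mem (ih (Subgroup.mem_map_of_mem _ hg)) ht)

end DescHNN

/-- **Theorem 2.** If `G` is a finitely generated group, `φ` is an injective but not
surjective endomorphism of `G`, and the subgroup `H = Gφ` is freely complemented in `G`,
then the descending HNN-extension `G(φ)` does not have the Howson property. -/
theorem descHNN_freelyComplemented_not_howson {G : Type*} [Group G] [Group.FG G]
    (φ : G →* G) (hφ : Function.Injective φ) (hns : ¬ Function.Surjective φ)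
    (hfc : FreelyComplemented (MonoidHom.range φ)) :
    ¬ HowsonGroup (DescHNN φ hφ) := by
  obtain ⟨K, hKbot, hK⟩ := hfc
  obtain ⟨k, hk, hk1⟩ := K.bot_or_exists_ne_one.resolve_left hKbot
  intro howson
  have hfg := howson (DescHNN.ofBase hφ).range
    (Subgroup.closure {DescHNN.ofBase hφ k, DescHNN.stable hφ})
    ((Group.fg_iff_subgroup_fg _).1 inferInstance)
    ((Subgroup.fg_iff _).2 ⟨_, rfl, Set.toFinite _⟩)
  have hinf : (DescHNN.ofBase hφ).range ⊓
      Subgroup.closure {DescHNN.ofBase hφ k, DescHNN.stable hφ} =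
      (⨆ n, orbitSubgroup φ k n).map (DescHNN.ofBase hφ) := by
    apply le_antisymm
    · rintro _ ⟨⟨g, rfl⟩, hg⟩
      obtain ⟨i, hi⟩ := DescHNN.exists_iterate_mem_of_ofBase_mem_closure hφ
        (fun _ => map_mem_iSup_orbitSubgroup φ k)
        ((mem_iSup_orbitSubgroup φ k).2 ⟨_, iterate_mem_orbitSubgroup φ k 0⟩) hg
      exact Subgroup.mem_map_of_mem _ (mem_iSup_orbitSubgroup_of_iterate_mem hφ hK hk i hi)
    · refine le_inf (Subgroup.map_le_range _ _) ?_
      rw [Subgroup.map_iSup]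
      exact iSup_le (DescHNN.map_orbitSubgroup_le_closure hφ k)
  rw [hinf] at hfg
  exact not_fg_iSup_orbitSubgroup hφ hK hk hk1 ((Subgroup.fg_iff_submonoid_fg _).2
    (((Subgroup.fg_iff_submonoid_fg _).1 hfg).map_injective _ (HNNExtension.of_injective _)))
end

section
/- Any descending HNN-extension of a non-cyclic finitely generated free group does not have the Howson property; that is, if G is a non-cyclic finitely generated free group and φ is any injective endomorphism of G (surjective or not), then G(φ) = ⟨G, t ; t⁻¹gt = gφ (g ∈ G)⟩ is not a Howson group. -/
section OrbitSubgroup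

variable {G Γ : Type*} [Group G] [Group Γ]

/-- The iterates of an endomorphism, bundled as endomorphisms. -/
def iterateHom (ψ : G →* G) (n : ℕ) : G →* G :=
  MonoidHom.mk' ψ^[n] fun x y => iterate_map_mul ψ n x y

@[simp]
theorem iterateHom_apply (ψ : G →* G) (n : ℕ) (g : G) : iterateHom ψ n g = ψ^[n] g := rfl

/-- The subgroup generated by the forward orbit of `b` under the endomorphism `ψ`. -/
def orbitClosure (ψ : G →* G) (b : G) : Subgroup G :=
  Subgroup.closure (Set.range fun n : ℕ => (ψ^[n]) b)

theorem iterate_mem_orbitClosure (ψ : G →* G) (b : G) (n : ℕ) :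
    (ψ^[n]) b ∈ orbitClosure ψ b :=
  Subgroup.subset_closure ⟨n, rfl⟩

theorem map_mem_orbitClosure (ψ : G →* G) (b : G) {x : G} (hx : x ∈ orbitClosure ψ b) :
    ψ x ∈ orbitClosure ψ b := by
  have h : orbitClosure ψ b ≤ (orbitClosure ψ b).comap ψ := by
    refine (Subgroup.closure_le _).2 ?_
    rintro _ ⟨n, rfl⟩
    have := iterate_mem_orbitClosure ψ b (n + 1)
    rwa [Function.iterate_succ_apply'] at this
  exact h hx

theorem iterate_map_mem_orbitClosure (ψ : G →* G) (b : G) (n : ℕ) {x : G}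
    (hx : x ∈ orbitClosure ψ b) : (ψ^[n]) x ∈ orbitClosure ψ b := by
  induction n with
  | zero => exact hx
  | succ n ih =>
    rw [Function.iterate_succ_apply']
    exact map_mem_orbitClosure ψ b ih

/-- A finitely generated orbit subgroup is generated by an initial segment of the orbit. -/
theorem exists_orbitClosure_le_of_fg {ψ : G →* G} {b : G} (h : (orbitClosure ψ b).FG) :
    ∃ k : ℕ, orbitClosure ψ b ≤ Subgroup.closure ((fun n : ℕ => (ψ^[n]) b) '' Set.Iio k) := by
  classical
  set f : ℕ → Subgroup G :=
    fun k => Subgroup.closure ((fun n : ℕ => (ψ^[n]) b) '' Set.Iio k) with hf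
  have hmono : Monotone f := fun i j hij =>
    Subgroup.closure_mono (Set.image_mono (Set.Iio_subset_Iio hij))
  have hle : orbitClosure ψ b ≤ ⨆ k, f k := by
    refine (Subgroup.closure_le _).2 ?_
    rintro _ ⟨n, rfl⟩
    exact le_iSup f (n + 1) (Subgroup.subset_closure ⟨n, Nat.lt_succ_self n, rfl⟩)
  obtain ⟨S, hS⟩ := h
  have hex : ∀ x ∈ S, ∃ k, x ∈ f k := fun x hx =>
    (Subgroup.mem_iSup_of_directed hmono.directed_le).1
      (hle (hS ▸ Subgroup.subset_closure hx))
  choose! g hg using hex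
  refine ⟨S.sup g, ?_⟩
  rw [← hS]
  exact (Subgroup.closure_le _).2 fun x hx => hmono (Finset.le_sup hx) (hg x hx)

theorem conj_pow_eq_iterate {i : G →* Γ} {s : Γ} {ψ : G →* G}
    (hs : ∀ g, s⁻¹ * i g * s = i (ψ g)) (n : ℕ) (g : G) :
    (s ^ n)⁻¹ * i g * s ^ n = i ((ψ^[n]) g) := by
  induction n with
  | zero => simp
  | succ n ih =>
    rw [Function.iterate_succ_apply', ← hs, ← ih]
    group

/-- Elements of `⟨s, i b⟩` are conjugated, up to powers of `s`, into the orbit subgroup. -/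
theorem exists_pow_mul_mem_orbitClosure {i : G →* Γ} {s : Γ} {ψ : G →* G}
    (hs : ∀ g, s⁻¹ * i g * s = i (ψ g)) (b : G) {x : Γ}
    (hx : x ∈ Subgroup.closure {s, i b}) :
    ∃ m n : ℕ, ∃ y ∈ orbitClosure ψ b, (s ^ m)⁻¹ * x * s ^ n = i y := by
  induction hx using Subgroup.closure_induction_left with
  | one => exact ⟨0, 0, 1, one_mem _, by simp⟩
  | mul_left z hz x _ ih =>
    obtain ⟨m, n, y, hy, h⟩ := ih
    rcases hz with rfl | rfl
    · refine ⟨m + 1, n, y, hy, ?_⟩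
      rw [← h, pow_succ']
      group
    · refine ⟨m, n, (ψ^[m]) b * y, mul_mem (iterate_mem_orbitClosure ψ b m) hy, ?_⟩
      rw [map_mul, ← h, ← conj_pow_eq_iterate hs]
      group
  | inv_mul_cancel z hz x _ ih =>
    obtain ⟨m, n, y, hy, h⟩ := ih
    rcases hz with rfl | rfl
    · refine ⟨m, n + 1, ψ y, map_mem_orbitClosure ψ b hy, ?_⟩
      rw [← hs, ← h, pow_succ]
      group
    · refine ⟨m, n, ((ψ^[m]) b)⁻¹ * y,
        mul_mem (inv_mem (iterate_mem_orbitClosure ψ b m)) hy, ?_⟩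
      rw [map_mul, map_inv, ← h, ← conj_pow_eq_iterate hs]
      group

/-- In a Howson group containing `G` as a finitely generated subgroup, with an element `s`
inducing `ψ` on `G` by conjugation and detected by a character trivial on `G`, the orbit
subgroups of `ψ` are finitely generated. -/
theorem HowsonGroup.fg_orbitClosure [Group.FG G] (hΓ : HowsonGroup Γ) {i : G →* Γ}
    (hi : Function.Injective i) {s : Γ} {ψ : G →* G} (hs : ∀ g, s⁻¹ * i g * s = i (ψ g))
    (χ : Γ →* Multiplicative ℤ) (hχi : ∀ g, χ (i g) = 1) (hχs : χ s ≠ 1) (b : G) :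
    (orbitClosure ψ b).FG := by
  classical
  have hK : (Subgroup.closure {s, i b} : Subgroup Γ).FG := ⟨{s, i b}, by simp⟩
  have hL : i.range.FG := (Group.fg_iff_subgroup_fg _).1 (Group.fg_range i)
  have hfg := hΓ _ _ hK hL
  set M : Subgroup G := (Subgroup.closure {s, i b}).comap i with hM
  have hMmap : M.map i = Subgroup.closure {s, i b} ⊓ i.range := by
    rw [hM, Subgroup.map_comap_eq, inf_comm]
  have hMfg : M.FG := by
    rw [← hMmap] at hfg
    rw [← Group.fg_iff_subgroup_fg] at hfg ⊢
    exact Group.fg_of_surjective (f := (M.equivMapOfInjective i hi).symm.toMonoidHom)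
      (M.equivMapOfInjective i hi).symm.surjective
  have hinto : ∀ g ∈ M, ∃ n : ℕ, (ψ^[n]) g ∈ orbitClosure ψ b := by
    intro g hg
    obtain ⟨m, n, y, hy, h⟩ := exists_pow_mul_mem_orbitClosure hs b hg
    have hmn : m = n := by
      have h' := congrArg χ h
      simp only [map_mul, map_inv, map_pow, hχi, mul_one] at h'
      have h'' : χ s ^ n = χ s ^ m := by rwa [inv_mul_eq_one, eq_comm] at h'
      have h3 := congrArg Multiplicative.toAdd h''
      simp only [toAdd_pow, nsmul_eq_mul] at h3
      exact_mod_cast (mul_right_cancel₀ (fun h0 => hχs (toAdd_eq_zero.1 h0)) h3).symm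
    subst hmn
    rw [conj_pow_eq_iterate hs] at h
    exact ⟨m, hi h ▸ hy⟩
  have hMorb : ∀ n, (ψ^[n]) b ∈ M := by
    intro n
    change i _ ∈ Subgroup.closure {s, i b}
    rw [← conj_pow_eq_iterate hs]
    have h1 : s ∈ Subgroup.closure {s, i b} := Subgroup.subset_closure (by simp)
    have h2 : i b ∈ Subgroup.closure {s, i b} := Subgroup.subset_closure (by simp)
    exact mul_mem (mul_mem (inv_mem (pow_mem h1 n)) h2) (pow_mem h1 n)
  obtain ⟨S, hS⟩ := hMfg
  choose! e he using hinto
  have hSM : ∀ x ∈ S, x ∈ M := fun x hx => hS ▸ Subgroup.subset_closure hx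
  set n := S.sup e with hnS
  have hn : ∀ x ∈ S, (ψ^[n]) x ∈ orbitClosure ψ b := by
    intro x hx
    obtain ⟨d, hd⟩ := Nat.exists_eq_add_of_le' (Finset.le_sup hx : e x ≤ S.sup e)
    rw [hnS, hd, Function.iterate_add_apply]
    exact iterate_map_mem_orbitClosure ψ b d (he x (hSM x hx))
  set T : Finset G := (Finset.range n).image (fun m => (ψ^[m]) b) ∪ S.image (ψ^[n])
  refine ⟨T, le_antisymm ?_ ?_⟩
  · refine (Subgroup.closure_le _).2 fun x hx => ?_
    rcases Finset.mem_union.1 hx with hx | hx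
    · obtain ⟨m, -, rfl⟩ := Finset.mem_image.1 hx
      exact iterate_mem_orbitClosure ψ b m
    · obtain ⟨y, hy, rfl⟩ := Finset.mem_image.1 hx
      exact hn y hy
  · have hMT : M ≤ (Subgroup.closure (T : Set G)).comap (iterateHom ψ n) := by
      rw [← hS]
      refine (Subgroup.closure_le _).2 fun x hx => Subgroup.subset_closure ?_
      refine Finset.mem_union_right _ (Finset.mem_image.2 ⟨x, hx, rfl⟩)
    refine (Subgroup.closure_le _).2 ?_
    rintro _ ⟨m, rfl⟩
    rcases lt_or_ge m n with h | h
    · exact Subgroup.subset_closure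
        (Finset.mem_union_left _ (Finset.mem_image.2 ⟨m, Finset.mem_range.2 h, rfl⟩))
    · obtain ⟨d, rfl⟩ := Nat.exists_eq_add_of_le h
      have := hMT (hMorb d)
      rw [Subgroup.mem_comap, iterateHom_apply] at this
      change (ψ^[n + d]) b ∈ _
      rwa [Function.iterate_add_apply]

end OrbitSubgroup

theorem DescHNN.inv_t_mul_of_mul_t_s2 {G : Type*} [Group G] (φ : G →* G)
    (hφ : Function.Injective φ) (g : G) :
    (HNNExtension.t : DescHNN φ hφ)⁻¹ * HNNExtension.of g * HNNExtension.t =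
      HNNExtension.of (φ g) := by
  have h := HNNExtension.equiv_symm_eq_conj (G := G) (A := φ.range) (B := ⊤)
    (φ := (MonoidHom.ofInjective hφ).symm.trans Subgroup.topEquiv.symm) ⟨g, trivial⟩
  rw [← h]
  rfl

/-- If `G(φ)` is Howson, then orbit subgroups of `g ↦ c⁻¹ (φ^k g) c` are finitely generated. The
statement allows for an isomorphic copy `F` of `G`. -/
theorem DescHNN.fg_orbitClosure {F G : Type*} [Group F] [Group G] [Group.FG F] {φ : G →* G}
    {hφ : Function.Injective φ} (h : HowsonGroup (DescHNN φ hφ)) (e : F ≃* G) {θ : F →* F}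
    (hθ : ∀ g, φ (e g) = e (θ g)) {k : ℕ} (hk : k ≠ 0) (c : F)
    (ψ : F →* F) (hψ : ∀ g, ψ g = c⁻¹ * (θ^[k]) g * c) (b : F) : (orbitClosure ψ b).FG := by
  set i : F →* DescHNN φ hφ := HNNExtension.of.comp e.toMonoidHom with hi
  have hit : ∀ g, (HNNExtension.t : DescHNN φ hφ)⁻¹ * i g * HNNExtension.t = i (θ g) := by
    intro g
    simp only [hi, MonoidHom.comp_apply, MulEquiv.coe_toMonoidHom, ← hθ]
    exact DescHNN.inv_t_mul_of_mul_t_s2 φ hφ (e g)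
  refine h.fg_orbitClosure (i := i) ((HNNExtension.of_injective _).comp e.injective)
    (s := HNNExtension.t ^ k * i c) ?_
    (HNNExtension.lift 1 (Multiplicative.ofAdd 1) (by simp)) (by simp [hi]) ?_ b
  · intro g
    rw [hψ, map_mul, map_mul, map_inv, ← conj_pow_eq_iterate hit k g]
    group
  · simp only [hi, MonoidHom.comp_apply, map_mul, map_pow, HNNExtension.lift_t,
      HNNExtension.lift_of, MonoidHom.one_apply, mul_one, ← ofAdd_nsmul]
    simpa using hk

section FreeRetraction

theorem FreeGroup.exists_finite_lift_eq {ι : Type*} (w : FreeGroup ι) :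
    ∃ S : Set ι, S.Finite ∧
      ∀ f : ι → FreeGroup ι, (∀ i ∈ S, f i = FreeGroup.of i) → FreeGroup.lift f w = w := by
  induction w using FreeGroup.induction_on with
  | C1 => exact ⟨∅, Set.finite_empty, fun f _ => _root_.map_one _⟩
  | of i => exact ⟨{i}, Set.finite_singleton i, fun f hf => by simp [hf i rfl]⟩
  | inv_of i _ => exact ⟨{i}, Set.finite_singleton i, fun f hf => by simp [hf i rfl]⟩
  | mul x y hx hy =>
    obtain ⟨S, hS, hx⟩ := hx
    obtain ⟨T, hT, hy⟩ := hy
    refine ⟨S ∪ T, hS.union hT, fun f hf => ?_⟩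
    rw [_root_.map_mul, hx f fun i hi => hf i (Or.inl hi), hy f fun i hi => hf i (Or.inr hi)]

/-- A finitely generated subgroup of a free group on infinitely many generators is fixed by an
endomorphism with non-trivial kernel. -/
theorem FreeGroup.exists_retraction {ι : Type*} [Infinite ι] {Q : Subgroup (FreeGroup ι)}
    (hQ : Q.FG) :
    ∃ ρ : FreeGroup ι →* FreeGroup ι, (∃ x, x ≠ 1 ∧ ρ x = 1) ∧ ∀ q ∈ Q, ρ q = q := by
  classical
  obtain ⟨T, hT⟩ := hQ
  choose S hS hlift using FreeGroup.exists_finite_lift_eq (ι := ι)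
  have hfin : (⋃ w ∈ T, S w).Finite := T.finite_toSet.biUnion fun w _ => hS w
  obtain ⟨i, hi⟩ := hfin.exists_notMem
  set f : ι → FreeGroup ι := fun j => if j = i then 1 else FreeGroup.of j with hf
  refine ⟨FreeGroup.lift f, ⟨FreeGroup.of i, FreeGroup.of_ne_one i, by simp [hf]⟩, ?_⟩
  have hle : Q ≤ (FreeGroup.lift f).eqLocus (MonoidHom.id _) := by
    rw [← hT]
    refine (Subgroup.closure_le _).2 fun w hw => hlift w f fun j hj => ?_
    have hji : j ≠ i := by
      rintro rfl
      exact hi (Set.mem_biUnion hw hj)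
    simp [hf, hji]
  exact fun q hq => hle hq

theorem FreeGroup.finite_of_fg_s2 {ι : Type*} [h : Group.FG (FreeGroup ι)] : Finite ι := by
  by_contra hfin
  rw [not_finite_iff_infinite] at hfin
  obtain ⟨ρ, ⟨x, hx, hρx⟩, hρ⟩ := FreeGroup.exists_retraction (Group.fg_def.1 h)
  exact hx ((hρ x trivial).symm.trans hρx)

theorem IsFreeGroup.exists_retraction {P : Type*} [Group P] [IsFreeGroup P]
    (hP : ¬ Group.FG P) {Q : Subgroup P} (hQ : Q.FG) :
    ∃ ρ : P →* P, (∃ x, x ≠ 1 ∧ ρ x = 1) ∧ ∀ q ∈ Q, ρ q = q := by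
  set e := IsFreeGroup.toFreeGroup P
  have : Infinite (IsFreeGroup.Generators P) := by
    rw [← not_finite_iff_infinite]
    intro hfin
    exact hP (Group.fg_of_surjective (f := e.symm.toMonoidHom) e.symm.surjective)
  have := (Group.fg_iff_subgroup_fg Q).2 hQ
  obtain ⟨ρ, ⟨x, hx, hρx⟩, hρ⟩ := FreeGroup.exists_retraction
    ((Group.fg_iff_subgroup_fg _).1 (Group.fg_range (e.toMonoidHom.comp Q.subtype)))
  refine ⟨e.symm.toMonoidHom.comp (ρ.comp e.toMonoidHom), ⟨e.symm x, ?_, ?_⟩, fun q hq => ?_⟩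
  · simpa using hx
  · simp [hρx]
  · have : ρ (e q) = e q := hρ _ ⟨⟨q, hq⟩, rfl⟩
    simp [this]

/-- If a map retracting a subgroup onto a subgroup containing the image of an injective
endomorphism `φ` kills `x ≠ 1`, then the orbit of `x` under `φ` is not contained in a finitely
generated subgroup spanned by an initial segment. -/
theorem not_fg_orbitClosure_of_retraction {G : Type*} [Group G] {φ : G →* G}
    (hφ : Function.Injective φ) {P : Subgroup G} (hP : ∀ g, φ g ∈ P) (ρ : P →* P)
    (hρ : ∀ g, ρ ⟨φ g, hP g⟩ = ⟨φ g, hP g⟩) {x : P} (hx : x ≠ 1) (hρx : ρ x = 1) :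
    ¬ (orbitClosure φ (x : G)).FG := by
  intro h
  obtain ⟨k, hk⟩ := exists_orbitClosure_le_of_fg h
  have key : ∀ k : ℕ, (φ^[k]) (x : G) ∉
      Subgroup.closure ((fun n : ℕ => (φ^[n]) (x : G)) '' Set.Iio k) := by
    intro k
    induction k with
    | zero => simpa using hx
    | succ k ih =>
      intro hmem
      set C := Subgroup.closure ((fun n : ℕ => (φ^[n]) (x : G)) '' Set.Iio k) with hC
      have hle : Subgroup.closure ((fun n : ℕ => (φ^[n]) (x : G)) '' Set.Iio (k + 1)) ≤
          ((C.map φ).comap (P.subtype.comp ρ)).map P.subtype := by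
        refine (Subgroup.closure_le _).2 ?_
        rintro _ ⟨n, hn, rfl⟩
        cases n with
        | zero =>
          refine ⟨x, ?_, rfl⟩
          simpa [hρx] using ⟨1, one_mem C, map_one φ⟩
        | succ n =>
          refine ⟨⟨φ ((φ^[n]) x), hP _⟩, ?_, (Function.iterate_succ_apply' _ _ _).symm⟩
          simp only [Subgroup.coe_comap, Set.mem_preimage, MonoidHom.comp_apply, hρ]
          exact ⟨_, Subgroup.subset_closure ⟨n, Nat.lt_of_succ_lt_succ hn, rfl⟩, rfl⟩
      obtain ⟨y, hy, hyk⟩ := hle hmem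
      rw [Function.iterate_succ_apply'] at hyk
      obtain rfl : y = ⟨φ ((φ^[k]) x), hP _⟩ := Subtype.ext hyk
      simp only [Subgroup.coe_comap, Set.mem_preimage, MonoidHom.comp_apply, hρ] at hy
      obtain ⟨z, hz, hzk⟩ := hy
      exact ih (hφ hzk ▸ hz)
  exact key k (hk (iterate_mem_orbitClosure φ _ k))

/-- An injective endomorphism of a finitely generated free group whose image lies in a subgroup
that is not finitely generated has an orbit generating a subgroup that is not finitely
generated. -/
theorem exists_not_fg_orbitClosure_of_forall_mem {G : Type*} [Group G] [IsFreeGroup G]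
    [Group.FG G] {φ : G →* G} (hφ : Function.Injective φ) {P : Subgroup G}
    (hP : ∀ g, φ g ∈ P) (hPfg : ¬ P.FG) : ∃ x, ¬ (orbitClosure φ x).FG := by
  have hP' : ¬ Group.FG P := by rwa [Group.fg_iff_subgroup_fg]
  have hQ : (φ.codRestrict P hP).range.FG := (Group.fg_iff_subgroup_fg _).1 (Group.fg_range _)
  obtain ⟨ρ, ⟨x, hx, hρx⟩, hρ⟩ := IsFreeGroup.exists_retraction hP' hQ
  exact ⟨x, not_fg_orbitClosure_of_retraction hφ hP ρ (fun g => hρ _ ⟨g, rfl⟩) hx hρx⟩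

end FreeRetraction

section FoxCalculus

open AddMonoidAlgebra

variable {X B : Type*} [AddCommGroup B]

/-- The map from the free group to the integral group ring of `B` induced by `π`. -/
noncomputable def groupRingHom (π : FreeGroup X →* Multiplicative B) :
    FreeGroup X →* AddMonoidAlgebra ℤ B :=
  (AddMonoidAlgebra.of ℤ B).comp π

theorem groupRingHom_apply (π : FreeGroup X →* Multiplicative B) (w : FreeGroup X) :
    groupRingHom π w = single (π w).toAdd 1 := rfl

/-- Two crossed homomorphisms on a free group agreeing on the generators are equal. -/
theorem FreeGroup.crossedHom_ext {R M : Type*} [Ring R] [AddCommGroup M] [Module R M]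
    (e : FreeGroup X →* R) {d d' : FreeGroup X → M}
    (hd : ∀ u w, d (u * w) = d u + e u • d w) (hd' : ∀ u w, d' (u * w) = d' u + e u • d' w)
    (h : ∀ x, d (FreeGroup.of x) = d' (FreeGroup.of x)) (w : FreeGroup X) : d w = d' w := by
  have h1 : d 1 = 0 := by simpa using hd 1 1
  have h1' : d' 1 = 0 := by simpa using hd' 1 1
  induction w using FreeGroup.induction_on with
  | C1 => rw [h1, h1']
  | of x => exact h x
  | inv_of x _ =>
    have a := hd (FreeGroup.of x)⁻¹ (FreeGroup.of x)
    have a' := hd' (FreeGroup.of x)⁻¹ (FreeGroup.of x)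
    rw [inv_mul_cancel, h1, h] at a
    rw [inv_mul_cancel, h1'] at a'
    exact add_right_cancel (a.symm.trans a')
  | mul u w hu hw => rw [hd, hd', hu, hw]

theorem commutator_mem_ker (π : FreeGroup X →* Multiplicative B) (u w : FreeGroup X) :
    u * w * u⁻¹ * w⁻¹ ∈ π.ker := by
  simp [MonoidHom.mem_ker]

variable [DecidableEq X]

/-- The affine action of the free group on `X → ℤ[B]` in which the generator `x` acts by
multiplication by its image under `π` followed by translation by the basis vector at `x`. -/
noncomputable def magnusAction (π : FreeGroup X →* Multiplicative B) :
    FreeGroup X →* Equiv.Perm (X → AddMonoidAlgebra ℤ B) :=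
  FreeGroup.lift fun x =>
    { toFun := fun v => groupRingHom π (FreeGroup.of x) • v + Pi.single x 1
      invFun := fun v => groupRingHom π (FreeGroup.of x)⁻¹ • (v - Pi.single x 1)
      left_inv := fun v => by
        dsimp only
        rw [add_sub_cancel_right, smul_smul, ← map_mul, inv_mul_cancel, map_one, one_smul]
      right_inv := fun v => by
        dsimp only
        rw [smul_smul, ← map_mul, mul_inv_cancel, map_one, one_smul, sub_add_cancel] }

/-- The vector of Fox derivatives of `w`, with coefficients pushed to `ℤ[B]` along `π`. -/
noncomputable def foxDeriv (π : FreeGroup X →* Multiplicative B) (w : FreeGroup X) :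
    X → AddMonoidAlgebra ℤ B :=
  magnusAction π w 0

theorem magnusAction_apply (π : FreeGroup X →* Multiplicative B) (w : FreeGroup X)
    (v : X → AddMonoidAlgebra ℤ B) :
    magnusAction π w v = groupRingHom π w • v + foxDeriv π w := by
  unfold foxDeriv
  induction w using FreeGroup.induction_on generalizing v with
  | C1 => simp
  | of x => simp [magnusAction]
  | inv_of x _ =>
    simp only [magnusAction, map_inv, FreeGroup.lift_apply_of, Equiv.Perm.inv_def]
    simp [sub_eq_add_neg]
  | mul u w hu hw =>
    rw [map_mul, map_mul, Equiv.Perm.mul_apply, Equiv.Perm.mul_apply, hw, hu,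
      hu (magnusAction π w 0), smul_add, smul_smul, add_assoc]

theorem foxDeriv_mul (π : FreeGroup X →* Multiplicative B) (u w : FreeGroup X) :
    foxDeriv π (u * w) = foxDeriv π u + groupRingHom π u • foxDeriv π w := by
  rw [add_comm, ← magnusAction_apply]
  simp [foxDeriv]

@[simp]
theorem foxDeriv_one (π : FreeGroup X →* Multiplicative B) : foxDeriv π 1 = 0 := by
  simp [foxDeriv]

@[simp]
theorem foxDeriv_of (π : FreeGroup X →* Multiplicative B) (x : X) :
    foxDeriv π (FreeGroup.of x) = Pi.single x 1 := by
  simp [foxDeriv, magnusAction]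

theorem foxDeriv_mul_of_mem_ker {π : FreeGroup X →* Multiplicative B} {u : FreeGroup X}
    (hu : u ∈ π.ker) (w : FreeGroup X) :
    foxDeriv π (u * w) = foxDeriv π u + foxDeriv π w := by
  rw [foxDeriv_mul, groupRingHom, MonoidHom.comp_apply, MonoidHom.mem_ker.1 hu, map_one, one_smul]

theorem foxDeriv_inv_of_mem_ker {π : FreeGroup X →* Multiplicative B} {u : FreeGroup X}
    (hu : u ∈ π.ker) : foxDeriv π u⁻¹ = -foxDeriv π u := by
  have h := foxDeriv_mul_of_mem_ker hu u⁻¹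
  rw [mul_inv_cancel, foxDeriv_one] at h
  exact (neg_eq_of_add_eq_zero_right h.symm).symm

theorem groupRingHom_smul_foxDeriv_conj {π : FreeGroup X →* Multiplicative B}
    {y : FreeGroup X} (hy : y ∈ π.ker) (u : FreeGroup X) :
    groupRingHom π u • foxDeriv π (u⁻¹ * y * u) = foxDeriv π y := by
  have h1 := foxDeriv_mul π u (u⁻¹ * y * u)
  have h2 := foxDeriv_mul_of_mem_ker hy u
  rw [show u * (u⁻¹ * y * u) = y * u by group, h2, add_comm] at h1
  exact (add_left_cancel h1).symm

theorem coeff_foxDeriv_conj {π : FreeGroup X →* Multiplicative B}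
    {y : FreeGroup X} (hy : y ∈ π.ker) (u : FreeGroup X) (x : X) (m : B) :
    (foxDeriv π (u⁻¹ * y * u) x).coeff m = (foxDeriv π y x).coeff ((π u).toAdd + m) := by
  rw [← groupRingHom_smul_foxDeriv_conj hy u, Pi.smul_apply, groupRingHom_apply, smul_eq_mul,
    coeff_single_mul_add, one_mul]

/-- The Fox derivatives of the elements of a finitely generated subgroup of `π.ker` are supported
in a common finite set. -/
theorem exists_finite_support_foxDeriv [Finite X] {π : FreeGroup X →* Multiplicative B}
    {N : Subgroup (FreeGroup X)} (hN : N.FG) (hker : N ≤ π.ker) :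
    ∃ S : Set B, S.Finite ∧
      ∀ w ∈ N, ∀ x m, (foxDeriv π w x).coeff m ≠ 0 → m ∈ S := by
  obtain ⟨T, hT⟩ := hN
  set S : Set B := ⋃ w ∈ T, ⋃ x : X, (foxDeriv π w x).coeff.support with hS
  have hfin : S.Finite := T.finite_toSet.biUnion fun w _ =>
    Set.finite_iUnion fun x => (foxDeriv π w x).coeff.support.finite_toSet
  have hTker : (T : Set (FreeGroup X)) ⊆ π.ker :=
    fun w hw => hker (hT ▸ Subgroup.subset_closure hw)
  refine ⟨S, hfin, fun w hw x m => ?_⟩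
  contrapose
  intro hm
  rw [← hT] at hw
  suffices h : w ∈ π.ker ∧ (foxDeriv π w x).coeff m = 0 from h.2
  induction hw using Subgroup.closure_induction with
  | mem w hw =>
    refine ⟨hTker hw, ?_⟩
    by_contra hne
    exact hm (Set.mem_biUnion hw (Set.mem_iUnion.2 ⟨x, Finsupp.mem_support_iff.2 hne⟩))
  | one => exact ⟨one_mem _, by simp⟩
  | mul u w _ _ hu hw =>
    refine ⟨mul_mem hu.1 hw.1, ?_⟩
    rw [foxDeriv_mul_of_mem_ker hu.1, Pi.add_apply, coeff_add, Finsupp.add_apply, hu.2, hw.2,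
      add_zero]
  | inv u _ hu =>
    refine ⟨inv_mem hu.1, ?_⟩
    rw [foxDeriv_inv_of_mem_ker hu.1, Pi.neg_apply, coeff_neg, Finsupp.neg_apply, hu.2, neg_zero]

theorem foxDeriv_commutator_apply (π : FreeGroup X →* Multiplicative B) {x y : X} (h : x ≠ y) :
    foxDeriv π (FreeGroup.of x * FreeGroup.of y * (FreeGroup.of x)⁻¹ * (FreeGroup.of y)⁻¹) y =
      single (π (FreeGroup.of x)).toAdd 1 - 1 := by
  have h1 := foxDeriv_mul_of_mem_ker (commutator_mem_ker π (FreeGroup.of x) (FreeGroup.of y))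
    (FreeGroup.of y * FreeGroup.of x)
  have h2 : FreeGroup.of x * FreeGroup.of y * (FreeGroup.of x)⁻¹ * (FreeGroup.of y)⁻¹ *
      (FreeGroup.of y * FreeGroup.of x) = FreeGroup.of x * FreeGroup.of y := by group
  rw [h2, foxDeriv_mul π (FreeGroup.of x) (FreeGroup.of y),
    foxDeriv_mul π (FreeGroup.of y) (FreeGroup.of x)] at h1
  have h3 := congrFun h1 y
  simp only [foxDeriv_of, Pi.add_apply, Pi.smul_apply, Pi.single_eq_same,
    Pi.single_eq_of_ne' h, smul_eq_mul, mul_zero, mul_one, zero_add, add_zero] at h3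
  rw [← groupRingHom_apply, h3, add_sub_cancel_right]

/-- The kernel of a homomorphism to `ℤ` that is non-trivial on a generator is not finitely
generated, as soon as there is another generator. -/
theorem FreeGroup.not_fg_ker [Finite X] (π : FreeGroup X →* Multiplicative ℤ) {x y : X}
    (h : x ≠ y) (hx : π (FreeGroup.of x) ≠ 1) : ¬ π.ker.FG := by
  intro hfg
  obtain ⟨S, hS, hsupp⟩ := exists_finite_support_foxDeriv hfg le_rfl
  set v := (π (FreeGroup.of x)).toAdd with hv
  have hv0 : v ≠ 0 := fun h0 => hx (toAdd_eq_zero.1 h0)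
  have hmem : ∀ n : ℕ, -(n * v) ∈ S := by
    intro n
    set c := FreeGroup.of x * FreeGroup.of y * (FreeGroup.of x)⁻¹ * (FreeGroup.of y)⁻¹
    have hc : c ∈ π.ker := commutator_mem_ker π _ _
    refine hsupp ((FreeGroup.of x ^ n)⁻¹ * c * FreeGroup.of x ^ n) ?_ y _ ?_
    · simpa [MonoidHom.mem_ker] using hc
    · rw [coeff_foxDeriv_conj hc, foxDeriv_commutator_apply π h, ← hv]
      rw [map_pow, toAdd_pow, nsmul_eq_mul, ← hv, add_neg_cancel, coeff_sub, Finsupp.sub_apply,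
        one_def, coeff_single, coeff_single, Finsupp.single_apply, Finsupp.single_apply]
      simp [hv0]
  refine Set.infinite_of_injective_forall_mem (f := fun n : ℕ => -(n * v)) ?_ hmem hS
  intro m n hmn
  simpa [hv0] using hmn

end FoxCalculus

section FreeAbelianization

open AddMonoidAlgebra Matrix

/-- Iterates of `g ↦ c⁻¹ (φ^k g) c`. -/
theorem iterate_conj_iterate {G : Type*} [Group G] {φ ψ : G →* G} {k : ℕ} {c : G}
    (hψ : ∀ g, ψ g = c⁻¹ * (φ^[k]) g * c) (n : ℕ) (b : G) :
    (ψ^[n]) b = ((fun u => (φ^[k]) u * c)^[n] 1)⁻¹ * (φ^[k * n]) b *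
      (fun u => (φ^[k]) u * c)^[n] 1 := by
  induction n with
  | zero => simp
  | succ n ih =>
    rw [Function.iterate_succ_apply', Function.iterate_succ_apply', ih, hψ, mul_add_one, add_comm,
      Function.iterate_add_apply, iterate_map_mul, iterate_map_mul, iterate_map_inv]
    group

variable {X : Type*} [DecidableEq X]

/-- The abelianization map of a free group. -/
def freeAb : FreeGroup X →* Multiplicative (X → ℤ) :=
  FreeGroup.lift fun x => Multiplicative.ofAdd (Pi.single x 1)

@[simp]
theorem freeAb_of (x : X) :
    freeAb (FreeGroup.of x) = Multiplicative.ofAdd (Pi.single x 1 : X → ℤ) := by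
  simp [freeAb]

/-- The matrix of the abelianization of an endomorphism of a free group. -/
def abMatrix (φ : FreeGroup X →* FreeGroup X) : Matrix X X ℤ :=
  Matrix.of fun j => (freeAb (φ (FreeGroup.of j))).toAdd

/-- The Jacobian matrix of Fox derivatives of an endomorphism of a free group. -/
noncomputable def foxJacobian (φ : FreeGroup X →* FreeGroup X) :
    Matrix X X (AddMonoidAlgebra ℤ (X → ℤ)) :=
  Matrix.of fun j => foxDeriv freeAb (φ (FreeGroup.of j))

/-- The augmentation of the Fox derivatives is the abelianization. -/
theorem lift_one_foxDeriv_freeAb (w : FreeGroup X) (i : X) :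
    AddMonoidAlgebra.lift ℤ ℤ (X → ℤ) 1 (foxDeriv freeAb w i) = (freeAb w).toAdd i := by
  refine FreeGroup.crossedHom_ext (1 : FreeGroup X →* ℤ)
    (d := fun w => AddMonoidAlgebra.lift ℤ ℤ (X → ℤ) 1 (foxDeriv freeAb w i))
    (d' := fun w => (freeAb w).toAdd i) (fun u w => ?_) (fun u w => by simp) (fun x => ?_) w
  · simp [foxDeriv_mul, groupRingHom_apply]
  · by_cases h : i = x
    · subst h; simp
    · simp [h]

variable [Fintype X]

/-- The abelianization of an endomorphism of a free group. -/
def abMap (φ : FreeGroup X →* FreeGroup X) : (X → ℤ) →+ (X → ℤ) :=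
  (abMatrix φ).vecMulLinear.toAddMonoidHom

theorem toAdd_freeAb_map (φ : FreeGroup X →* FreeGroup X) (w : FreeGroup X) :
    (freeAb (φ w)).toAdd = abMap φ (freeAb w).toAdd := by
  refine FreeGroup.crossedHom_ext (1 : FreeGroup X →* ℤ)
    (d := fun w => (freeAb (φ w)).toAdd) (d' := fun w => abMap φ (freeAb w).toAdd)
    (fun u w => by simp) (fun u w => by simp) (fun x => ?_) w
  simp [abMap, abMatrix, Matrix.row]
  rfl

theorem toAdd_freeAb_iterate (φ : FreeGroup X →* FreeGroup X) (k : ℕ) (w : FreeGroup X) :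
    (freeAb ((φ^[k]) w)).toAdd = (abMap φ)^[k] (freeAb w).toAdd := by
  induction k with
  | zero => rfl
  | succ k ih => rw [Function.iterate_succ_apply', Function.iterate_succ_apply',
      toAdd_freeAb_map, ih]

theorem abMap_injective {φ : FreeGroup X →* FreeGroup X} (h : (abMatrix φ).det ≠ 0) :
    Function.Injective (abMap φ) :=
  (injective_iff_map_eq_zero _).2 fun _ hv => Matrix.eq_zero_of_vecMul_eq_zero h hv

/-- The chain rule for Fox derivatives. -/
theorem foxDeriv_freeAb_map (φ : FreeGroup X →* FreeGroup X) (w : FreeGroup X) :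
    foxDeriv freeAb (φ w) =
      (fun i => mapDomainRingHom ℤ (abMap φ) (foxDeriv freeAb w i)) ᵥ* foxJacobian φ := by
  refine FreeGroup.crossedHom_ext ((groupRingHom freeAb).comp φ)
    (d := fun w => foxDeriv freeAb (φ w))
    (d' := fun w => (fun i => mapDomainRingHom ℤ (abMap φ) (foxDeriv freeAb w i)) ᵥ*
      foxJacobian φ) (fun u w => ?_) (fun u w => ?_) (fun x => ?_) w
  · simp [foxDeriv_mul]
  · rw [← Matrix.smul_vecMul, ← Matrix.add_vecMul]
    congr 1
    ext1 i
    simp only [foxDeriv_mul, Pi.add_apply, Pi.smul_apply, smul_eq_mul, map_add, map_mul,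
      MonoidHom.comp_apply, groupRingHom_apply, toAdd_freeAb_map]
    simp
  · have : (fun i => mapDomainRingHom ℤ (abMap φ) (foxDeriv freeAb (FreeGroup.of x) i)) =
        Pi.single x 1 := by
      ext1 i
      by_cases h : i = x
      · subst h; simp
      · simp [h]
    rw [this, Matrix.single_one_vecMul]
    rfl

theorem foxJacobian_det_ne_zero {φ : FreeGroup X →* FreeGroup X} (h : (abMatrix φ).det ≠ 0) :
    (foxJacobian φ).det ≠ 0 := by
  intro h0
  apply h
  have := congrArg (AddMonoidAlgebra.lift ℤ ℤ (X → ℤ) 1).toRingHom h0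
  rw [RingHom.map_det, map_zero] at this
  rw [← this]
  congr 1
  ext j i
  exact (lift_one_foxDeriv_freeAb _ _).symm

theorem foxDeriv_iterate_ne_zero {φ : FreeGroup X →* FreeGroup X} (h : (abMatrix φ).det ≠ 0)
    {w : FreeGroup X} (hw : foxDeriv freeAb w ≠ 0) (n : ℕ) :
    foxDeriv freeAb ((φ^[n]) w) ≠ 0 := by
  induction n with
  | zero => exact hw
  | succ n ih =>
    rw [Function.iterate_succ_apply', foxDeriv_freeAb_map]
    contrapose! ih
    have h1 := Matrix.eq_zero_of_vecMul_eq_zero (foxJacobian_det_ne_zero h) ih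
    ext1 i
    exact mapDomain_injective (abMap_injective h) ((congrFun h1 i).trans (map_zero
      (mapDomainRingHom ℤ (abMap φ))).symm)

/-- If all orbit subgroups of the maps `g ↦ c⁻¹ (φ^k g) c` are finitely generated, then the
translation parts of the powers of these maps have only finitely many abelianizations. -/
theorem finite_range_freeAb_iterate {φ : FreeGroup X →* FreeGroup X}
    (h : (abMatrix φ).det ≠ 0) [Nontrivial X] {k : ℕ}
    (H : ∀ (c : FreeGroup X) (ψ : FreeGroup X →* FreeGroup X),
      (∀ g, ψ g = c⁻¹ * (φ^[k]) g * c) → ∀ b, (orbitClosure ψ b).FG) (c : FreeGroup X) :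
    (Set.range fun n : ℕ =>
      (freeAb ((fun u => (φ^[k]) u * c)^[n] 1)).toAdd).Finite := by
  obtain ⟨x, y, hxy⟩ := exists_pair_ne X
  set b := FreeGroup.of x * FreeGroup.of y * (FreeGroup.of x)⁻¹ * (FreeGroup.of y)⁻¹
  have hb : b ∈ freeAb.ker := commutator_mem_ker _ _ _
  have hD : foxDeriv freeAb b ≠ 0 := by
    intro h0
    have h1 := congrFun h0 y
    rw [foxDeriv_commutator_apply freeAb hxy, Pi.zero_apply, sub_eq_zero, one_def,
      freeAb_of] at h1
    have h2 := congrArg (fun p => p.coeff 0) h1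
    have h3 : (Pi.single x 1 : X → ℤ) ≠ 0 := by simp
    simp [h3] at h2
  have hiter : ∀ n, (φ^[n]) b ∈ freeAb.ker := by
    intro n
    rw [MonoidHom.mem_ker, ← toAdd_eq_zero, toAdd_freeAb_iterate, MonoidHom.mem_ker.1 hb]
    exact iterate_map_zero _ _
  have key : ∀ (c : FreeGroup X) (ψ : FreeGroup X →* FreeGroup X),
      (∀ g, ψ g = c⁻¹ * (φ^[k]) g * c) → orbitClosure ψ b ≤ freeAb.ker := by
    intro c ψ hψ
    refine (Subgroup.closure_le _).2 ?_
    rintro _ ⟨n, rfl⟩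
    have := MonoidHom.mem_ker.1 (hiter (k * n))
    simp [MonoidHom.mem_ker, iterate_conj_iterate hψ, this]
  set ψ : FreeGroup X →* FreeGroup X := (MulAut.conj c⁻¹).toMonoidHom.comp (iterateHom φ k)
  have hψ : ∀ g, ψ g = c⁻¹ * (φ^[k]) g * c := fun g => by simp [ψ]
  have hφk : ∀ g, iterateHom φ k g = 1⁻¹ * (φ^[k]) g * 1 := fun g => by simp
  obtain ⟨S, hS, hSs⟩ := exists_finite_support_foxDeriv (H 1 _ hφk b) (key 1 _ hφk)
  obtain ⟨T, hT, hTs⟩ := exists_finite_support_foxDeriv (H c ψ hψ b) (key c ψ hψ)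
  refine (hS.sub hT).subset ?_
  rintro _ ⟨n, rfl⟩
  have hne := foxDeriv_iterate_ne_zero h hD (k * n)
  obtain ⟨j, hj⟩ := Function.ne_iff.1 hne
  obtain ⟨a, ha⟩ : ∃ a, (foxDeriv freeAb ((φ^[k * n]) b) j).coeff a ≠ 0 := by
    contrapose! hj
    ext a
    exact hj a
  have haS : a ∈ S := by
    refine hSs _ ?_ j a ha
    have := iterate_mem_orbitClosure (iterateHom φ k) b n
    rwa [Function.iterate_mul]
  have hmem := iterate_mem_orbitClosure ψ b n
  rw [iterate_conj_iterate hψ] at hmem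
  set u := (fun u => (φ^[k]) u * c)^[n] 1
  have haT : a - (freeAb u).toAdd ∈ T := by
    refine hTs _ hmem j _ ?_
    rwa [coeff_foxDeriv_conj (hiter _), add_sub_cancel]
  exact ⟨a, haS, _, haT, sub_sub_cancel _ _⟩

/-- Every injective endomorphism `φ` of a free group of finite rank at least two has some
`g ↦ c⁻¹ (φ^k g) c` with an orbit that generates a subgroup that is not finitely generated. -/
theorem FreeGroup.exists_not_fg_orbitClosure [Nontrivial X] {φ : FreeGroup X →* FreeGroup X}
    (hφ : Function.Injective φ) :
    ∃ k ≠ 0, ∃ (c : FreeGroup X) (ψ : FreeGroup X →* FreeGroup X) (b : FreeGroup X),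
      (∀ g, ψ g = c⁻¹ * (φ^[k]) g * c) ∧ ¬ (orbitClosure ψ b).FG := by
  by_cases h : (abMatrix φ).det = 0
  · obtain ⟨v, hv0, hv⟩ := Matrix.exists_mulVec_eq_zero_iff.2 h
    obtain ⟨i, hi⟩ := Function.ne_iff.1 hv0
    obtain ⟨j, hj⟩ := exists_ne i
    set χ : FreeGroup X →* Multiplicative ℤ := FreeGroup.lift fun x => Multiplicative.ofAdd (v x)
      with hχ
    have hχv : ∀ w, (χ w).toAdd = (freeAb w).toAdd ⬝ᵥ v := by
      intro w
      refine FreeGroup.crossedHom_ext (1 : FreeGroup X →* ℤ) (d := fun w => (χ w).toAdd)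
        (d' := fun w => (freeAb w).toAdd ⬝ᵥ v) (fun u w => by simp)
        (fun u w => by simp [add_dotProduct]) (fun x => by simp [χ]) w
    have hker : ∀ g, φ g ∈ χ.ker := by
      intro g
      rw [MonoidHom.mem_ker, ← toAdd_eq_zero, hχv, toAdd_freeAb_map]
      change (_ ᵥ* abMatrix φ) ⬝ᵥ v = 0
      rw [← Matrix.dotProduct_mulVec, hv, dotProduct_zero]
    obtain ⟨b, hb⟩ := exists_not_fg_orbitClosure_of_forall_mem hφ hker
      (FreeGroup.not_fg_ker χ hj.symm (by simpa [χ] using hi))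
    exact ⟨1, one_ne_zero, 1, φ, b, by simp, hb⟩
  · by_contra! H
    have hfin := fun (k : ℕ) (hk : k ≠ 0) => finite_range_freeAb_iterate h
      fun c ψ hψ b => H k hk c ψ b hψ
    obtain ⟨x⟩ : Nonempty X := inferInstance
    set e : X → ℤ := Pi.single x 1 with he
    have hstep : ∀ k n : ℕ,
        (freeAb ((fun u => (φ^[k]) u * FreeGroup.of x)^[n + 1] 1)).toAdd =
          (abMap φ)^[k] (freeAb ((fun u => (φ^[k]) u * FreeGroup.of x)^[n] 1)).toAdd + e := by
      intro k n
      rw [Function.iterate_succ_apply', _root_.map_mul, toAdd_mul, toAdd_freeAb_iterate, freeAb_of,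
        toAdd_ofAdd]
    have hdiff : ∀ n : ℕ, (freeAb ((fun u => (φ^[1]) u * FreeGroup.of x)^[n + 1] 1)).toAdd -
        (freeAb ((fun u => (φ^[1]) u * FreeGroup.of x)^[n] 1)).toAdd = (abMap φ)^[n] e := by
      intro n
      induction n with
      | zero => rw [hstep]; simp
      | succ n ih =>
        rw [hstep 1 (n + 1)]
        nth_rw 2 [hstep 1 n]
        rw [Function.iterate_one, add_sub_add_right_eq_sub, ← map_sub, ih,
          Function.iterate_succ_apply']
    have hnot : ¬ Function.Injective fun n : ℕ => (abMap φ)^[n] e := by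
      intro hinj
      refine Set.infinite_of_injective_forall_mem hinj (fun n => ?_)
        ((hfin 1 one_ne_zero (FreeGroup.of x)).sub (hfin 1 one_ne_zero (FreeGroup.of x)))
      exact ⟨_, ⟨n + 1, rfl⟩, _, ⟨n, rfl⟩, hdiff n⟩
    obtain ⟨k, hk, hke⟩ : ∃ k : ℕ, k ≠ 0 ∧ (abMap φ)^[k] e = e := by
      simp only [Function.Injective, not_forall] at hnot
      obtain ⟨m, n, hmn, hne⟩ := hnot
      wlog hlt : m < n generalizing m n
      · exact this n m hmn.symm (Ne.symm hne) (lt_of_le_of_ne (not_lt.1 hlt) (Ne.symm hne))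
      obtain ⟨d, rfl⟩ := Nat.exists_eq_add_of_lt hlt
      refine ⟨d + 1, d.succ_ne_zero, ((abMap_injective h).iterate m ?_).symm⟩
      rwa [← Function.iterate_add_apply, ← add_assoc]
    have hmul : ∀ n : ℕ,
        (freeAb ((fun u => (φ^[k]) u * FreeGroup.of x)^[n] 1)).toAdd = n • e := by
      intro n
      induction n with
      | zero => simp
      | succ n ih => rw [hstep, ih, iterate_map_nsmul, hke, succ_nsmul]
    refine Set.infinite_of_injective_forall_mem (f := fun n : ℕ => n • e) (fun m n hmn => ?_)
      (fun n => Set.mem_range.2 ⟨n, hmul n⟩) (hfin k hk (FreeGroup.of x))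
    simpa [he] using congrFun hmn x

end FreeAbelianization

/-- Any descending HNN-extension of a non-cyclic finitely generated free group does not
have the Howson property: if `G` is a non-cyclic finitely generated free group and `φ` is
any injective endomorphism of `G` (surjective or not), then `G(φ)` is not a Howson group. -/
theorem descHNN_of_free_not_howson' {G : Type*} [Group G] [IsFreeGroup G] [Group.FG G]
    (hnc : ¬ IsCyclic G) (φ : G →* G) (hφ : Function.Injective φ) :
    ¬ HowsonGroup (DescHNN φ hφ) := by
  classical
  intro h
  set e := IsFreeGroup.toFreeGroup G
  have hfg : Group.FG (FreeGroup (IsFreeGroup.Generators G)) :=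
    Group.fg_of_surjective (f := e.toMonoidHom) e.surjective
  have := FreeGroup.finite_of_fg_s2 (h := hfg)
  have := Fintype.ofFinite (IsFreeGroup.Generators G)
  have : Nontrivial (IsFreeGroup.Generators G) := by
    by_contra hsub
    rw [not_nontrivial_iff_subsingleton] at hsub
    refine hnc ?_
    have : IsCyclic (FreeGroup (IsFreeGroup.Generators G)) := by
      cases isEmpty_or_nonempty (IsFreeGroup.Generators G)
      · infer_instance
      · have := uniqueOfSubsingleton (Classical.arbitrary (IsFreeGroup.Generators G))
        infer_instance
    exact isCyclic_of_surjective e.symm e.symm.surjective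
  set θ := e.toMonoidHom.comp (φ.comp e.symm.toMonoidHom) with hθ
  obtain ⟨k, hk, c, ψ, b, hψ, hb⟩ := FreeGroup.exists_not_fg_orbitClosure (φ := θ)
    (e.injective.comp (hφ.comp e.symm.injective))
  exact hb (DescHNN.fg_orbitClosure h e.symm (fun g => by simp [hθ]) hk c ψ hψ b)
end

section
/- Let the group G be the direct product of non-identity groups A and B, and let φ be an injective but not surjective endomorphism of G such that Aφ ⊆ A and Bφ ⊆ B. If Aφ ≠ A, Bφ ≠ B, and at least one of the subgroups A and B is finitely generated, then the descending HNN-extension G(φ) = ⟨G, t ; t⁻¹gt = gφ (g ∈ G)⟩ does not have the Howson property. -/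
section AscendingUnion

variable {Γ A B : Type*} [Group Γ] [Group A] [Group B]

theorem map_mul_pow_of_conj {ι : A →* Γ} {α : A →* A} {s : Γ}
    (h : ∀ a, ι a * s = s * ι (α a)) (n : ℕ) (a : A) :
    ι a * s ^ n = s ^ n * ι (α^[n] a) := by
  induction n generalizing a with
  | zero => simp
  | succ n ih => rw [pow_succ', ← mul_assoc, h, mul_assoc, ih, Function.iterate_succ_apply,
      mul_assoc]

theorem pow_mul_map_mul_pow_inv_add {ι : A →* Γ} {α : A →* A} {s : Γ}
    (h : ∀ a, ι a * s = s * ι (α a)) (i j n : ℕ) (a : A) :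
    s ^ i * ι a * (s ^ j)⁻¹ = s ^ (i + n) * ι (α^[n] a) * (s ^ (j + n))⁻¹ := by
  rw [pow_add, mul_assoc (s ^ i) (s ^ n), ← map_mul_pow_of_conj h, add_comm j, pow_add]
  group

/-- Elements of the subgroup generated by the base and the stable letter have the normal form
`sⁱ a s⁻ʲ`. -/
theorem exists_eq_pow_mul_map_mul_pow_inv {ι : A →* Γ} {α : A →* A} {s : Γ}
    (h : ∀ a, ι a * s = s * ι (α a)) {x : Γ} (hx : x ∈ ι.range ⊔ Subgroup.zpowers s) :
    ∃ (i j : ℕ) (a : A), x = s ^ i * ι a * (s ^ j)⁻¹ := by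
  rw [Subgroup.zpowers_eq_closure, ← Subgroup.closure_eq ι.range, ← Subgroup.closure_union] at hx
  have base (c : A) (i j : ℕ) (a : A) :
      ι c * (s ^ i * ι a * (s ^ j)⁻¹) = s ^ i * ι (α^[i] c * a) * (s ^ j)⁻¹ := by
    rw [← mul_assoc, ← mul_assoc, map_mul_pow_of_conj h, map_mul, mul_assoc (s ^ i)]
  induction hx using Subgroup.closure_induction_left with
  | one => exact ⟨0, 0, 1, by simp⟩
  | mul_left x hx y _ ih =>
    obtain ⟨i, j, a, rfl⟩ := ih
    obtain ⟨c, rfl⟩ | rfl := hx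
    · exact ⟨i, j, _, base c i j a⟩
    · exact ⟨i + 1, j, a, by rw [pow_succ']; simp only [mul_assoc]⟩
  | inv_mul_cancel x hx y _ ih =>
    obtain ⟨i, j, a, rfl⟩ := ih
    obtain ⟨c, rfl⟩ | rfl := hx
    · exact ⟨i, j, _, by rw [← map_inv, base]⟩
    · refine ⟨i, j + 1, α a, ?_⟩
      rw [inv_mul_eq_iff_eq_mul]
      have := pow_mul_map_mul_pow_inv_add h i j 1 a
      rw [this, pow_succ']
      simp only [mul_assoc, Function.iterate_one]

/-- The product `βⁿ⁻¹(b) ⋯ β(b) b`, so that `(t b)ⁿ = tⁿ · twistedPow β b n` when conjugation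
by `t⁻¹` acts as `β`. -/
def twistedPow (β : B →* B) (b : B) : ℕ → B
  | 0 => 1
  | n + 1 => β (twistedPow β b n) * b

theorem mul_pow_eq_pow_mul_twistedPow {ι : B →* Γ} {β : B →* B} {t : Γ}
    (h : ∀ b, ι b * t = t * ι (β b)) (b : B) (n : ℕ) :
    (t * ι b) ^ n = t ^ n * ι (twistedPow β b n) := by
  induction n with
  | zero => simp [twistedPow]
  | succ n ih =>
    rw [pow_succ, ih, twistedPow, map_mul, pow_succ, mul_assoc, ← mul_assoc (ι _) t, h]
    simp only [mul_assoc]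

theorem twistedPow_injective {β : B →* B} (hβ : Function.Injective β) {b : B}
    (hb : b ∉ β.range) : Function.Injective (twistedPow β b) := by
  have succ_ne_one (n : ℕ) : β (twistedPow β b n) * b ≠ 1 := fun h =>
    hb ⟨(twistedPow β b n)⁻¹, by rw [map_inv, inv_eq_of_mul_eq_one_right h]⟩
  intro i
  induction i with
  | zero =>
    rintro (_ | j) h
    · rfl
    · exact absurd h.symm (succ_ne_one j)
  | succ i ih =>
    rintro (_ | j) h
    · exact absurd h (succ_ne_one i)
    · rw [ih (hβ (mul_right_cancel h))]

/-- If the conjugates `tⁿ A t⁻ⁿ` form a strictly ascending chain, then their union is not finitely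
generated. -/
theorem not_fg_of_mem_iff_exists_conj_pow {ι : A →* Γ} (hι : Function.Injective ι) {α : A →* A}
    {t : Γ} (h : ∀ a, ι a * t = t * ι (α a)) (hα : ¬ Function.Surjective α) {L : Subgroup Γ}
    (hL : ∀ x, x ∈ L ↔ ∃ (n : ℕ) (a : A), x = t ^ n * ι a * (t ^ n)⁻¹) : ¬ L.FG := by
  rintro ⟨S, hS⟩
  have hmem (x : S) : ∃ (n : ℕ) (a : A), (x : Γ) = t ^ n * ι a * (t ^ n)⁻¹ :=
    (hL x).1 (hS ▸ Subgroup.subset_closure x.2)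
  choose f g hfg using hmem
  obtain ⟨N, hN⟩ := (Set.finite_range f).bddAbove
  have hle : L ≤ ι.range.map (MulAut.conj (t ^ N)).toMonoidHom := by
    rw [← hS, Subgroup.closure_le]
    intro x hx
    obtain ⟨k, rfl⟩ := Nat.exists_eq_add_of_le (hN ⟨⟨x, hx⟩, rfl⟩)
    refine ⟨_, ⟨α^[k] (g ⟨x, hx⟩), rfl⟩, ?_⟩
    exact ((hfg ⟨x, hx⟩).trans (pow_mul_map_mul_pow_inv_add h _ _ k _)).symm
  refine hα fun a => ?_
  obtain ⟨_, ⟨c, rfl⟩, hc⟩ := hle ((hL _).2 ⟨N + 1, a, rfl⟩)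
  refine ⟨c, hι ?_⟩
  have hc' : t ^ N * ι c * (t ^ N)⁻¹ = t ^ (N + 1) * ι a * (t ^ (N + 1))⁻¹ := hc
  rw [pow_mul_map_mul_pow_inv_add h N N 1] at hc'
  exact mul_left_cancel (mul_right_cancel hc')

/-- If `A` and `B` commute and `b ∉ β.range`, then `⟨A, t⟩ ⊓ ⟨A, t b⟩` is the union of the
conjugates `tⁿ A t⁻ⁿ`. -/
theorem not_howsonGroup_of_commuting_bases {ιA : A →* Γ} {ιB : B →* Γ} {α : A →* A} {β : B →* B}
    {t : Γ} (hA : ∀ a, ιA a * t = t * ιA (α a)) (hB : ∀ b, ιB b * t = t * ιB (β b))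
    (hcomm : ∀ a b, Commute (ιA a) (ιB b)) (hιA : Function.Injective ιA)
    (hιB : Function.Injective ιB) (hdisj : Disjoint ιA.range ιB.range)
    (hα : ¬ Function.Surjective α) (hβ : Function.Injective β) (hβs : ¬ Function.Surjective β)
    (χ : Γ →* Multiplicative ℤ) (hχt : χ t = Multiplicative.ofAdd 1) (hχA : ∀ a, χ (ιA a) = 1)
    (hχB : ∀ b, χ (ιB b) = 1) (hfg : Group.FG A) : ¬ HowsonGroup Γ := by
  obtain ⟨b, hb⟩ : ∃ b, b ∉ β.range := by
    by_contra! H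
    exact hβs H
  set s := t * ιB b with hs
  have hsA (a : A) : ιA a * s = s * ιA (α a) := by
    rw [hs, ← mul_assoc, hA, mul_assoc, mul_assoc, (hcomm _ b).eq]
  have hpow := mul_pow_eq_pow_mul_twistedPow hB b
  rw [← hs] at hpow
  have hχs : χ s = Multiplicative.ofAdd 1 := by rw [hs, map_mul, hχt, hχB, mul_one]
  have hrange : ιA.range.FG := (Group.fg_iff_subgroup_fg _).1 (Group.fg_range ιA)
  have hz (x : Γ) : (Subgroup.zpowers x).FG := ⟨{x}, by simp [Subgroup.zpowers_eq_closure]⟩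
  intro hH
  refine not_fg_of_mem_iff_exists_conj_pow hιA hA hα (fun x => ⟨?_, ?_⟩)
    (hH _ _ (hrange.sup (hz t)) (hrange.sup (hz s)))
  · rintro ⟨hxt, hxs⟩
    obtain ⟨i, j, a, hx⟩ := exists_eq_pow_mul_map_mul_pow_inv hA hxt
    obtain ⟨k, l, c, hx'⟩ := exists_eq_pow_mul_map_mul_pow_inv hsA hxs
    have hdeg : (i : ℤ) - j = k - l := by
      have := congrArg (fun y => Multiplicative.toAdd (χ y)) (hx.symm.trans hx')
      simpa [hχt, hχs, hχA, sub_eq_add_neg] using this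
    have hjl : l + i = j + k := by omega
    have key := hx.symm.trans hx'
    rw [pow_mul_map_mul_pow_inv_add hA i j k, pow_mul_map_mul_pow_inv_add hsA k l i, add_comm k i,
      hjl, hpow, hpow] at key
    generalize α^[k] a = a' at key
    generalize α^[i] c = c' at key
    generalize hP : twistedPow β b (i + k) = p at key
    generalize hQ : twistedPow β b (j + k) = q at key
    have key' : ιA a' = ιB p * ιA c' * (ιB q)⁻¹ := by
      rw [mul_inv_rev, ← mul_assoc] at key
      have := mul_right_cancel key
      simp only [mul_assoc] at this ⊢
      exact mul_left_cancel this
    have heq : ιA (a' * c'⁻¹) = ιB (p * q⁻¹) := by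
      rw [map_mul, map_inv, key', map_mul, map_inv, ← map_inv ιB, mul_assoc (ιB p),
        (hcomm c' q⁻¹).eq]
      group
    have h1 : ιB (p * q⁻¹) = 1 :=
      Subgroup.disjoint_def.1 hdisj ⟨_, heq⟩ ⟨_, rfl⟩
    have hpq : p = q := mul_inv_eq_one.1 ((map_eq_one_iff ιB hιB).1 h1)
    have hij : i = j := by
      have := twistedPow_injective hβ hb (hP.trans (hpq.trans hQ.symm))
      omega
    exact ⟨i, a, by rw [hx, hij]⟩
  · rintro ⟨n, a, rfl⟩
    have hconj : t ^ n * ιA a * (t ^ n)⁻¹ = s ^ n * ιA a * (s ^ n)⁻¹ := by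
      rw [hpow, mul_assoc (t ^ n) (ιB _), ← (hcomm a _).eq]
      group
    have hmem (u : Γ) : u ^ n * ιA a * (u ^ n)⁻¹ ∈ ιA.range ⊔ Subgroup.zpowers u := by
      have hu : u ^ n ∈ ιA.range ⊔ Subgroup.zpowers u :=
        pow_mem (Subgroup.mem_sup_right (Subgroup.mem_zpowers u)) n
      exact mul_mem (mul_mem hu (Subgroup.mem_sup_left ⟨a, rfl⟩)) (inv_mem hu)
    exact ⟨hmem t, hconj ▸ hmem s⟩

end AscendingUnion

section DescHNN

variable {G : Type*} [Group G] {φ : G →* G} (hφ : Function.Injective φ)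

theorem DescHNN.of_mul_t (g : G) :
    (HNNExtension.of g : DescHNN φ hφ) * HNNExtension.t =
      HNNExtension.t * HNNExtension.of (φ g) := by
  have h := HNNExtension.t_mul_of (φ := (MonoidHom.ofInjective hφ).symm.trans
    Subgroup.topEquiv.symm) (MonoidHom.ofInjective hφ g)
  simpa [MonoidHom.ofInjective_apply] using h.symm

/-- The exponent sum of the stable letter. -/
noncomputable def DescHNN.exponentSum_s4 : DescHNN φ hφ →* Multiplicative ℤ :=
  HNNExtension.lift 1 (Multiplicative.ofAdd (1 : ℤ)) (by simp)

end DescHNN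


/-- **Theorem 3.** Let `G = A × B` be the direct product of non-identity groups `A` and
`B`, and let `φ` be an injective but not surjective endomorphism of `G` with `Aφ ⊆ A` and
`Bφ ⊆ B`. If `Aφ ≠ A`, `Bφ ≠ B`, and at least one of `A`, `B` is finitely generated, then
`G(φ)` does not have the Howson property. -/
theorem descHNN_of_direct_product_not_howson {A B : Type*} [Group A] [Group B]
    [Nontrivial A] [Nontrivial B]
    (φ : A × B →* A × B) (hφ : Function.Injective φ) (hns : ¬ Function.Surjective φ)
    (hAφ : ((MonoidHom.inl A B).range).map φ ≤ (MonoidHom.inl A B).range)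
    (hBφ : ((MonoidHom.inr A B).range).map φ ≤ (MonoidHom.inr A B).range)
    (hAne : ((MonoidHom.inl A B).range).map φ ≠ (MonoidHom.inl A B).range)
    (hBne : ((MonoidHom.inr A B).range).map φ ≠ (MonoidHom.inr A B).range)
    (hfg : Group.FG A ∨ Group.FG B) :
    ¬ HowsonGroup (DescHNN φ hφ) := by
  set α : A →* A := (MonoidHom.fst A B).comp (φ.comp (MonoidHom.inl A B)) with hα
  set β : B →* B := (MonoidHom.snd A B).comp (φ.comp (MonoidHom.inr A B)) with hβ
  have hφA (a : A) : φ (MonoidHom.inl A B a) = MonoidHom.inl A B (α a) := by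
    obtain ⟨c, hc⟩ := hAφ ⟨_, ⟨a, rfl⟩, rfl⟩
    rw [hα, MonoidHom.comp_apply, MonoidHom.comp_apply, ← hc]
    rfl
  have hφB (b : B) : φ (MonoidHom.inr A B b) = MonoidHom.inr A B (β b) := by
    obtain ⟨c, hc⟩ := hBφ ⟨_, ⟨b, rfl⟩, rfl⟩
    rw [hβ, MonoidHom.comp_apply, MonoidHom.comp_apply, ← hc]
    rfl
  have hinl : Function.Injective (MonoidHom.inl A B) := Prod.mk_left_injective 1
  have hinr : Function.Injective (MonoidHom.inr A B) := Prod.mk_right_injective 1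
  have hαi : Function.Injective α := fun x y h => hinl (hφ (by rw [hφA, hφA, h]))
  have hβi : Function.Injective β := fun x y h => hinr (hφ (by rw [hφB, hφB, h]))
  have hαs : ¬ Function.Surjective α := fun h => hAne <| le_antisymm hAφ <| by
    rintro _ ⟨a, rfl⟩
    obtain ⟨c, rfl⟩ := h a
    exact ⟨_, ⟨c, rfl⟩, hφA c⟩
  have hβs : ¬ Function.Surjective β := fun h => hBne <| le_antisymm hBφ <| by
    rintro _ ⟨b, rfl⟩
    obtain ⟨c, rfl⟩ := h b
    exact ⟨_, ⟨c, rfl⟩, hφB c⟩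
  let ι : A × B →* DescHNN φ hφ := HNNExtension.of
  have hι : Function.Injective ι := HNNExtension.of_injective _
  let ιA := ι.comp (MonoidHom.inl A B)
  let ιB := ι.comp (MonoidHom.inr A B)
  have hA (a : A) : ιA a * HNNExtension.t = HNNExtension.t * ιA (α a) :=
    (DescHNN.of_mul_t hφ _).trans (by rw [hφA]; rfl)
  have hB (b : B) : ιB b * HNNExtension.t = HNNExtension.t * ιB (β b) :=
    (DescHNN.of_mul_t hφ _).trans (by rw [hφB]; rfl)
  have hcomm (a : A) (b : B) : Commute (ιA a) (ιB b) := (MonoidHom.commute_inl_inr a b).map ι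
  have hdisj : Disjoint ιA.range ιB.range := by
    rw [Subgroup.disjoint_def]
    rintro _ ⟨a, rfl⟩ ⟨b, h⟩
    have ha : (1 : A) = a := congrArg Prod.fst (hι h)
    rw [← ha, map_one]
  have hχ (g : A × B) : DescHNN.exponentSum_s4 hφ (ι g) = 1 := HNNExtension.lift_of ..
  have hχt : DescHNN.exponentSum_s4 hφ HNNExtension.t = Multiplicative.ofAdd 1 :=
    HNNExtension.lift_t ..
  obtain hfg | hfg := hfg
  · exact not_howsonGroup_of_commuting_bases hA hB hcomm (hι.comp hinl) (hι.comp hinr) hdisj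
      hαs hβi hβs _ hχt (fun _ => hχ _) (fun _ => hχ _) hfg
  · exact not_howsonGroup_of_commuting_bases hB hA (fun b a => (hcomm a b).symm) (hι.comp hinr)
      (hι.comp hinl) hdisj.symm hβs hαi hαs _ hχt (fun _ => hχ _) (fun _ => hχ _) hfg
end

section
/- (Lemma 1) Let G be a finitely generated group, φ an injective but not surjective endomorphism of G, H = Gφ, and K a non-identity finitely generated subgroup of G such that the subgroup L generated by H and K is their internal free product H ∗ K. In the descending HNN-extension G(φ) = ⟨G, t ; t⁻¹gt = gφ (g ∈ G)⟩ set Kₙ = t⁻ⁿKtⁿ for each integer n, and let N be the subgroup generated by all Kₙ (n ∈ ℤ). Then N is the internal free product of the family of subgroups Kₙ, n ∈ ℤ. -/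
open Monoid

universe u v

namespace Monoid

/-- The reduced word obtained by applying injective homomorphisms to the letters of `w`. -/
def CoprodI.Word.mapHom {ι : Type*} {M M' : ι → Type*} [∀ i, Group (M i)] [∀ i, Group (M' i)]
    (f : ∀ i, M i →* M' i) (hf : ∀ i, Function.Injective (f i)) (w : CoprodI.Word M) :
    CoprodI.Word M' where
  toList := w.toList.map fun p => ⟨p.1, f p.1 p.2⟩
  ne_one := by
    intro l hl
    obtain ⟨p, hp, rfl⟩ := List.mem_map.1 hl
    exact fun h => w.ne_one p hp ((map_eq_one_iff _ (hf p.1)).1 h)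
  chain_ne := (List.isChain_map _).2 w.chain_ne

theorem CoprodI.Word.prod_mapHom {ι : Type*} {M M' : ι → Type*} [∀ i, Group (M i)]
    [∀ i, Group (M' i)] (f : ∀ i, M i →* M' i) (hf : ∀ i, Function.Injective (f i))
    (w : CoprodI.Word M) :
    (w.mapHom f hf).prod = CoprodI.lift (fun i => (CoprodI.of (M := M')).comp (f i)) w.prod := by
  simp [CoprodI.Word.prod, CoprodI.Word.mapHom, map_list_prod, Function.comp_def]

theorem CoprodI.lift_of_comp_injective {ι : Type*} {M M' : ι → Type*} [∀ i, Group (M i)]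
    [∀ i, Group (M' i)] (f : ∀ i, M i →* M' i) (hf : ∀ i, Function.Injective (f i)) :
    Function.Injective (CoprodI.lift fun i => (CoprodI.of (M := M')).comp (f i)) := by
  classical
  rw [injective_iff_map_eq_one]
  intro x hx
  obtain ⟨w, rfl⟩ := CoprodI.Word.equiv.symm.surjective x
  change CoprodI.lift _ w.prod = 1 at hx
  rw [← CoprodI.Word.prod_mapHom f hf, ← CoprodI.Word.prod_empty] at hx
  have hw : w.mapHom f hf = CoprodI.Word.empty := CoprodI.Word.equiv.symm.injective hx
  have hnil : w.toList = [] := List.map_eq_nil_iff.1 (congrArg CoprodI.Word.toList hw)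
  have : w = CoprodI.Word.empty := CoprodI.Word.ext hnil
  subst this
  exact CoprodI.Word.prod_empty

/-- The two-element family of types consisting of `A` and `B`. -/
def Coprod.BoolFamily (A B : Type u) (b : Bool) : Type u := bif b then B else A

instance Coprod.BoolFamily.instGroup {A B : Type u} [Group A] [Group B] (b : Bool) :
    Group (Coprod.BoolFamily A B b) :=
  match b with
  | false => inferInstanceAs (Group A)
  | true => inferInstanceAs (Group B)

/-- The homomorphisms between two-element families given by two homomorphisms. -/
def Coprod.BoolFamily.map {A B : Type u} {A' B' : Type v} [Group A] [Group B] [Group A']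
    [Group B'] (f : A →* A') (g : B →* B') (b : Bool) :
    Coprod.BoolFamily A B b →* Coprod.BoolFamily A' B' b :=
  match b with
  | false => f
  | true => g

theorem Coprod.map_injective {A B : Type u} {A' B' : Type v} [Group A] [Group B] [Group A']
    [Group B'] {f : A →* A'} {g : B →* B'} (hf : Function.Injective f)
    (hg : Function.Injective g) : Function.Injective (Coprod.map f g) := by
  let M : Bool → Type u := Coprod.BoolFamily A B
  let M' : Bool → Type v := Coprod.BoolFamily A' B'
  let F : ∀ b, M b →* M' b := Coprod.BoolFamily.map f g
  have hF (b : Bool) : Function.Injective (F b) := by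
    cases b
    exacts [hf, hg]
  let iA : A →* CoprodI M := CoprodI.of (M := M) (i := false)
  let iB : B →* CoprodI M := CoprodI.of (M := M) (i := true)
  let q : ∀ b, M b →* Coprod A B := fun b => b.rec (Coprod.inl (M := A) (N := B)) Coprod.inr
  let iA' : A' →* CoprodI M' := CoprodI.of (M := M') (i := false)
  let iB' : B' →* CoprodI M' := CoprodI.of (M := M') (i := true)
  have hleft : (CoprodI.lift q).comp (Coprod.lift iA iB) = MonoidHom.id _ :=
    Coprod.hom_ext
      (MonoidHom.ext fun a => (congrArg (CoprodI.lift q) (Coprod.lift_apply_inl iA iB a)).trans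
        (CoprodI.lift_of q (i := false) a))
      (MonoidHom.ext fun b => (congrArg (CoprodI.lift q) (Coprod.lift_apply_inr iA iB b)).trans
        (CoprodI.lift_of q (i := true) b))
  have hi : Function.Injective (Coprod.lift iA iB) :=
    Function.LeftInverse.injective (DFunLike.congr_fun hleft)
  have hsq : (Coprod.lift iA' iB').comp (Coprod.map f g) =
      (CoprodI.lift fun b => (CoprodI.of (M := M')).comp (F b)).comp (Coprod.lift iA iB) := by
    refine Coprod.hom_ext (MonoidHom.ext fun a => ?_) (MonoidHom.ext fun b => ?_)
    · simp only [MonoidHom.comp_apply, Coprod.map_apply_inl, Coprod.lift_apply_inl]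
      exact (CoprodI.lift_of (fun b => (CoprodI.of (M := M')).comp (F b)) (i := false) a).symm
    · simp only [MonoidHom.comp_apply, Coprod.map_apply_inr, Coprod.lift_apply_inr]
      exact (CoprodI.lift_of (fun b => (CoprodI.of (M := M')).comp (F b)) (i := true) b).symm
  have h : Function.Injective ((Coprod.lift iA' iB').comp (Coprod.map f g)) := by
    rw [hsq]
    exact (CoprodI.lift_of_comp_injective F hF).comp hi
  exact Function.Injective.of_comp h

/-- Splitting off the first factor of a free product of `m + 1` copies of `K`. -/
def CoprodI.finSuccToCoprod (K : Type*) [Group K] (m : ℕ) :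
    CoprodI (fun _ : Fin (m + 1) => K) →* Coprod (CoprodI fun _ : Fin m => K) K :=
  CoprodI.lift (Fin.cons Coprod.inr fun i => Coprod.inl.comp
    (CoprodI.of (M := fun _ : Fin m => K) (i := i)))

theorem CoprodI.finSuccToCoprod_injective (K : Type*) [Group K] (m : ℕ) :
    Function.Injective (CoprodI.finSuccToCoprod K m) := by
  let r : Coprod (CoprodI fun _ : Fin m => K) K →* CoprodI (fun _ : Fin (m + 1) => K) :=
    Coprod.lift
      (CoprodI.lift fun i => CoprodI.of (M := fun _ : Fin (m + 1) => K) (i := i.succ))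
      (CoprodI.of (M := fun _ : Fin (m + 1) => K) (i := 0))
  have h : r.comp (CoprodI.finSuccToCoprod K m) = MonoidHom.id _ := by
    refine CoprodI.ext_hom _ _ fun i => ?_
    ext k
    refine Fin.cases ?_ (fun j => ?_) i <;> simp [r, CoprodI.finSuccToCoprod]
  exact Function.LeftInverse.injective (DFunLike.congr_fun h)

/-- The `n`-th iterate of an endomorphism, as a homomorphism. -/
def iterateHom {G : Type*} [Group G] (φ : G →* G) : ℕ → (G →* G)
  | 0 => MonoidHom.id G
  | n + 1 => φ.comp (iterateHom φ n)

theorem iterateHom_apply {G : Type*} [Group G] (φ : G →* G) (n : ℕ) (g : G) :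
    iterateHom φ n g = φ^[n] g := by
  induction n with
  | zero => rfl
  | succ n ih => rw [Function.iterate_succ_apply', ← ih, iterateHom, MonoidHom.comp_apply]

/-- The homomorphism mapping the copy of `K` with index `i` to its image under `φ^[i]`. -/
def CoprodI.liftIterate {G : Type*} [Group G] (φ : G →* G) (K : Subgroup G) (m : ℕ) :
    CoprodI (fun _ : Fin m => K) →* G :=
  CoprodI.lift fun i => (iterateHom φ i).comp K.subtype

theorem CoprodI.liftIterate_of {G : Type*} [Group G] (φ : G →* G) (K : Subgroup G) {m : ℕ}
    (i : Fin m) (k : K) :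
    CoprodI.liftIterate φ K m (CoprodI.of (M := fun _ : Fin m => K) (i := i) k) =
      φ^[(i : ℕ)] k := by
  rw [CoprodI.liftIterate, CoprodI.lift_of, MonoidHom.comp_apply, iterateHom_apply,
    Subgroup.subtype_apply]

theorem CoprodI.liftIterate_injective {G : Type*} [Group G] (φ : G →* G)
    (hφ : Function.Injective φ) (K : Subgroup G)
    (hfp : IsInternalFreeProductPair (MonoidHom.range φ) K) (m : ℕ) :
    Function.Injective (CoprodI.liftIterate φ K m) := by
  induction m with
  | zero =>
    rw [injective_iff_map_eq_one]
    intro x _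
    induction x using CoprodI.induction_left with
    | one => rfl
    | @mul i => exact i.elim0
  | succ m ih =>
    have hfac : CoprodI.liftIterate φ K (m + 1) =
        ((Coprod.lift φ.range.subtype K.subtype).comp
          (Coprod.map (φ.rangeRestrict.comp (CoprodI.liftIterate φ K m)) (MonoidHom.id K))).comp
          (CoprodI.finSuccToCoprod K m) := by
      refine CoprodI.ext_hom _ _ fun i => ?_
      ext k
      refine Fin.cases ?_ (fun j => ?_) i <;>
        simp [CoprodI.liftIterate_of, CoprodI.finSuccToCoprod, Function.iterate_succ_apply']
    rw [hfac]
    refine (hfp.comp (Coprod.map_injective ?_ Function.injective_id)).comp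
      (CoprodI.finSuccToCoprod_injective K m)
    exact (φ.rangeRestrict_injective_iff.2 hφ).comp ih

/-- The inclusion of the `2 * N + 1` free factors with indices in `[-N, N]`. -/
def CoprodI.windowHom (K : Type*) [Group K] (N : ℕ) :
    CoprodI (fun _ : Fin (2 * N + 1) => K) →* CoprodI (fun _ : ℤ => K) :=
  CoprodI.lift fun i => CoprodI.of (M := fun _ : ℤ => K) (i := (i : ℤ) - N)

theorem CoprodI.exists_mem_range_windowHom {K : Type*} [Group K] (x : CoprodI (fun _ : ℤ => K)) :
    ∃ N : ℕ, ∀ N' ≥ N, x ∈ (CoprodI.windowHom K N').range := by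
  induction x using CoprodI.induction_on with
  | one => exact ⟨0, fun _ _ => one_mem _⟩
  | of n k =>
    refine ⟨n.natAbs, fun N hN => ⟨CoprodI.of (i := ⟨(n + N).toNat, by omega⟩) k, ?_⟩⟩
    have hn : (((n + N).toNat : ℕ) : ℤ) - N = n := by omega
    rw [CoprodI.windowHom, CoprodI.lift_of]
    dsimp only
    rw [hn]
  | mul x y hx hy =>
    obtain ⟨a, ha⟩ := hx
    obtain ⟨b, hb⟩ := hy
    exact ⟨max a b, fun N hN => mul_mem (ha N (le_trans (le_max_left _ _) hN))
      (hb N (le_trans (le_max_right _ _) hN))⟩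

end Monoid

namespace DescHNN

open HNNExtension

variable {G : Type*} [Group G] {φ : G →* G} {hφ : Function.Injective φ}

theorem of_map (g : G) :
    (of (φ g) : DescHNN φ hφ) = t⁻¹ * of g * t := by
  have h := t_mul_of (A := φ.range) (B := ⊤)
    (φ := (MonoidHom.ofInjective hφ).symm.trans Subgroup.topEquiv.symm) ⟨φ g, g, rfl⟩
  have hg : (MonoidHom.ofInjective hφ).symm ⟨φ g, g, rfl⟩ = g :=
    (MonoidHom.ofInjective hφ).symm_apply_apply g
  simp only [MulEquiv.trans_apply, hg] at h
  rw [mul_assoc, eq_inv_mul_iff_mul_eq]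
  exact h

theorem of_iterate (n : ℕ) (g : G) :
    (of (φ^[n] g) : DescHNN φ hφ) = t ^ (-(n : ℤ)) * of g * t ^ (n : ℤ) := by
  induction n with
  | zero => simp
  | succ n ih =>
    rw [Function.iterate_succ_apply', of_map, ih]
    push_cast
    group

/-- The homomorphism from the free product of copies of `K` indexed by `ℤ` that sends
`k` in the `n`-th copy to `t ^ (-n) * k * t ^ n`. -/
noncomputable def liftConj (φ : G →* G) (hφ : Function.Injective φ) (K : Subgroup G) :
    CoprodI (fun _ : ℤ => K) →* DescHNN φ hφ :=
  CoprodI.lift fun n => ((MulAut.conj (t ^ (-n) : DescHNN φ hφ)).toMonoidHom.comp of).comp K.subtype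

theorem liftConj_injective (K : Subgroup G)
    (hfp : IsInternalFreeProductPair (MonoidHom.range φ) K) :
    Function.Injective (liftConj φ hφ K) := by
  rw [injective_iff_map_eq_one]
  intro x hx
  obtain ⟨N, hN⟩ := CoprodI.exists_mem_range_windowHom x
  obtain ⟨y, rfl⟩ := hN N le_rfl
  have hfac : (liftConj φ hφ K).comp (CoprodI.windowHom K N) =
      ((MulAut.conj (t ^ (N : ℤ) : DescHNN φ hφ)).toMonoidHom.comp of).comp
        (CoprodI.liftIterate φ K (2 * N + 1)) := by
    refine CoprodI.ext_hom _ _ fun i => ?_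
    ext k
    simp only [liftConj, CoprodI.windowHom, MonoidHom.comp_apply, CoprodI.liftIterate_of,
      CoprodI.lift_of, MulEquiv.coe_toMonoidHom, MulAut.conj_apply, of_iterate,
      Subgroup.subtype_apply]
    group
  have hinj : Function.Injective (((MulAut.conj (t ^ (N : ℤ) : DescHNN φ hφ)).toMonoidHom.comp
      of).comp (CoprodI.liftIterate φ K (2 * N + 1))) :=
    ((MulAut.conj (t ^ (N : ℤ) : DescHNN φ hφ)).injective.comp (of_injective _)).comp
      (CoprodI.liftIterate_injective φ hφ K hfp _)
  rw [← hfac] at hinj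
  rw [(injective_iff_map_eq_one _).1 hinj y hx, map_one]

end DescHNN


/-- **Lemma 1 (first part).** Let `G` be a finitely generated group, `φ` an injective but
not surjective endomorphism of `G`, `H = Gφ`, and `K` a non-identity finitely generated
subgroup of `G` such that the subgroup `L` generated by `H` and `K` is their internal
free product. In `G(φ)` set `Kₙ = t⁻ⁿKtⁿ` and let `N` be the subgroup generated by all
`Kₙ` (`n ∈ ℤ`). Then `N` is the internal free product of the family `Kₙ`, `n ∈ ℤ`:
the canonical homomorphism from the abstract free product `∗ₙ Kₙ` is injective, and its
range is `N`. -/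
theorem subgroup_N_is_free_product {G : Type*} [Group G] [Group.FG G]
    (φ : G →* G) (hφ : Function.Injective φ) (hns : ¬ Function.Surjective φ)
    (K : Subgroup G) (hK : K ≠ ⊥) (hKfg : K.FG)
    (hfp : IsInternalFreeProductPair (MonoidHom.range φ) K)
    (Kn : ℤ → Subgroup (DescHNN φ hφ))
    (hKn : ∀ n : ℤ, Kn n = (K.map (HNNExtension.of : G →* DescHNN φ hφ)).map
      (MulAut.conj (HNNExtension.t ^ (-n))).toMonoidHom)
    (N : Subgroup (DescHNN φ hφ)) (hN : N = ⨆ n : ℤ, Kn n) :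
    Function.Injective (Monoid.CoprodI.lift fun n : ℤ => (Kn n).subtype) ∧
      MonoidHom.range (Monoid.CoprodI.lift fun n : ℤ => (Kn n).subtype) = N := by
  have hrange (n : ℤ) : (Kn n) = (((MulAut.conj (HNNExtension.t ^ (-n) :
      DescHNN φ hφ)).toMonoidHom.comp HNNExtension.of).comp K.subtype).range := by
    rw [hKn, MonoidHom.range_comp, K.range_subtype, Subgroup.map_map]
  refine ⟨?_, ?_⟩
  · let c (n : ℤ) : K →* Kn n := (((MulAut.conj (HNNExtension.t ^ (-n) :
      DescHNN φ hφ)).toMonoidHom.comp HNNExtension.of).comp K.subtype).codRestrict (Kn n)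
        fun k => by rw [hrange]; exact ⟨k, rfl⟩
    have hc (n : ℤ) : Function.Surjective (c n) := by
      rintro ⟨x, hx⟩
      obtain ⟨k, hk⟩ := (hrange n).le hx
      exact ⟨k, Subtype.ext hk⟩
    let p : CoprodI (fun _ : ℤ => K) →* CoprodI fun n => Kn n :=
      CoprodI.lift fun n => CoprodI.of.comp (c n)
    have hp : Function.Surjective p := by
      intro x
      induction x using CoprodI.induction_on with
      | one => exact ⟨1, map_one p⟩
      | of n y =>
        obtain ⟨k, rfl⟩ := hc n y
        exact ⟨CoprodI.of (i := n) k, CoprodI.lift_of _ _⟩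
      | mul x y hx hy =>
        obtain ⟨a, rfl⟩ := hx
        obtain ⟨b, rfl⟩ := hy
        exact ⟨a * b, map_mul p a b⟩
    have hfac : (CoprodI.lift fun n : ℤ => (Kn n).subtype).comp p =
        DescHNN.liftConj φ hφ K := by
      refine CoprodI.ext_hom _ _ fun i => ?_
      ext k
      simp [p, c, DescHNN.liftConj]
    have hinj := DescHNN.liftConj_injective (hφ := hφ) K hfp
    rw [← hfac] at hinj
    exact Function.Injective.of_comp_right hinj hp
  · simp only [hN, CoprodI.range_eq_iSup, Subgroup.range_subtype]
end

section
/- Let G be a finitely generated group, φ an injective but not surjective endomorphism of G, H = Gφ, and K a non-identity finitely generated subgroup of G such that the subgroup L generated by H and K is their internal free product H ∗ K. In the descending HNN-extension G(φ) set Kₙ = t⁻ⁿKtⁿ for n ∈ ℤ, let N be the subgroup generated by all Kₙ (n ∈ ℤ) and M the subgroup generated by all Kₙ with n ≥ 0 (so that M ≤ G, since Kₙ = Kφⁿ for n ≥ 0). Then neither N nor M is finitely generated. -/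
theorem Subgroup.FG.exists_eq_of_eq_iSup_of_monotone {G : Type*} [Group G] {N : Subgroup G}
    (hN : N.FG) {L : ℕ → Subgroup G} (hL : Monotone L) (h : N = ⨆ n, L n) : ∃ n, N = L n := by
  obtain ⟨S, hS⟩ := hN
  have key : ∀ T : Finset G, (T : Set G) ⊆ N → ∃ n, (T : Set G) ⊆ L n := by
    intro T hT
    have hx : ∀ x ∈ T, ∃ n, x ∈ L n := fun x hx => by
      have : x ∈ ⨆ n, L n := h ▸ hT hx
      exact (Subgroup.mem_iSup_of_directed hL.directed_le).1 this
    choose! f hf using hx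
    exact ⟨T.sup f, fun x hx => hL (Finset.le_sup (f := f) hx) (hf x hx)⟩
  obtain ⟨n, hn⟩ := key S (hS ▸ Subgroup.subset_closure)
  refine ⟨n, le_antisymm ?_ (h ▸ le_iSup L n)⟩
  rw [← hS]
  exact (Subgroup.closure_le _).2 hn

/-- In an internal free product `H ∗ K`, the subgroup generated by `K` and a subgroup `A` of `H`
meets `H` in `A`. -/
theorem IsInternalFreeProductPair.mem_of_mem_sup {G : Type*} [Group G] {H K A : Subgroup G}
    (hfp : IsInternalFreeProductPair H K) (hA : A ≤ H) {h : G} (hH : h ∈ H) (hs : h ∈ K ⊔ A) :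
    h ∈ A := by
  have hle : K ⊔ A ≤ (((A.subgroupOf H).comap Monoid.Coprod.fst).map
      (Monoid.Coprod.lift H.subtype K.subtype)) := by
    refine sup_le (fun k hk => ?_) fun a ha => ?_
    · exact ⟨Monoid.Coprod.inr ⟨k, hk⟩, by simp, by simp⟩
    · exact ⟨Monoid.Coprod.inl ⟨a, hA ha⟩, by simpa [Subgroup.mem_subgroupOf] using ha, by simp⟩
  obtain ⟨w, hw, hwh⟩ := hle hs
  have hw' : w = Monoid.Coprod.inl ⟨h, hH⟩ := hfp (by simpa using hwh)
  subst hw'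
  simpa [Subgroup.mem_subgroupOf] using hw

/-- The subgroup generated by the images of `K` under the first `n` powers of `φ`. -/
def iterateHull {G : Type*} [Group G] (φ : G →* G) (K : Subgroup G) (n : ℕ) : Subgroup G :=
  (fun Q => K ⊔ Q.map φ)^[n] ⊥

theorem iterateHull_succ {G : Type*} [Group G] (φ : G →* G) (K : Subgroup G) (n : ℕ) :
    iterateHull φ K (n + 1) = K ⊔ (iterateHull φ K n).map φ :=
  Function.iterate_succ_apply' _ _ _

theorem iterateHull_monotone {G : Type*} [Group G] (φ : G →* G) (K : Subgroup G) :
    Monotone (iterateHull φ K) :=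
  Monotone.monotone_iterate_of_le_map
    (fun _ _ h => sup_le_sup_left (Subgroup.map_mono h) K) bot_le

theorem iterate_mem_iterateHull {G : Type*} [Group G] (φ : G →* G) {K : Subgroup G} {k : G}
    (hk : k ∈ K) (n : ℕ) : φ^[n] k ∈ iterateHull φ K (n + 1) := by
  rw [iterateHull_succ]
  cases n with
  | zero => exact Subgroup.mem_sup_left hk
  | succ n =>
    rw [Function.iterate_succ_apply']
    exact Subgroup.mem_sup_right ⟨_, iterate_mem_iterateHull φ hk n, rfl⟩

theorem iterateHull_le {G : Type*} [Group G] {φ : G →* G} {K Q : Subgroup G}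
    (hQ : ∀ k ∈ K, ∀ m : ℕ, φ^[m] k ∈ Q) (n : ℕ) : iterateHull φ K n ≤ Q := by
  induction n generalizing Q with
  | zero => exact bot_le
  | succ n ih =>
    rw [iterateHull_succ]
    refine sup_le (fun k hk => hQ k hk 0) (Subgroup.map_le_iff_le_comap.2 (ih fun k hk m => ?_))
    rw [Subgroup.mem_comap, ← Function.iterate_succ_apply' φ]
    exact hQ k hk (m + 1)

theorem eq_one_of_iterate_mem_iterateHull {G : Type*} [Group G] {φ : G →* G}
    (hφ : Function.Injective φ) {K : Subgroup G} (hfp : IsInternalFreeProductPair φ.range K)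
    {k : G} {n : ℕ} (h : φ^[n] k ∈ iterateHull φ K n) : k = 1 := by
  induction n with
  | zero => exact h
  | succ n ih =>
    rw [iterateHull_succ, Function.iterate_succ_apply'] at h
    exact ih ((Subgroup.mem_map_iff_mem hφ).1
      (hfp.mem_of_mem_sup (Subgroup.map_le_range _ _) ⟨_, rfl⟩ h))

theorem DescHNN.of_map_s8 {G : Type*} [Group G] (φ : G →* G) (hφ : Function.Injective φ) (g : G) :
    (HNNExtension.of (φ g) : DescHNN φ hφ) =
      HNNExtension.t⁻¹ * HNNExtension.of g * HNNExtension.t :=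
  HNNExtension.equiv_symm_eq_conj
    (φ := (MonoidHom.ofInjective hφ).symm.trans Subgroup.topEquiv.symm) ⟨g, trivial⟩

theorem DescHNN.of_iterate_s8 {G : Type*} [Group G] (φ : G →* G) (hφ : Function.Injective φ)
    (g : G) (n : ℕ) :
    (HNNExtension.of (φ^[n] g) : DescHNN φ hφ) =
      HNNExtension.t ^ (-(n : ℤ)) * HNNExtension.of g * HNNExtension.t ^ (n : ℤ) := by
  induction n with
  | zero => simp
  | succ n ih =>
    rw [Function.iterate_succ_apply', DescHNN.of_map_s8, ih]
    push_cast
    group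

/-- **Lemma 1 (second part).** Let `G` be a finitely generated group, `φ` an injective but
not surjective endomorphism of `G`, `H = Gφ`, and `K` a non-identity finitely generated
subgroup of `G` such that the subgroup generated by `H` and `K` is their internal free
product. In `G(φ)` set `Kₙ = t⁻ⁿKtⁿ`, let `N` be the subgroup generated by all `Kₙ`
(`n ∈ ℤ`) and `M` the subgroup generated by all `Kₙ` with `n ≥ 0`. Then neither `N` nor
`M` is finitely generated. -/
theorem subgroups_N_M_not_fg {G : Type*} [Group G] [Group.FG G]
    (φ : G →* G) (hφ : Function.Injective φ) (hns : ¬ Function.Surjective φ)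
    (K : Subgroup G) (hK : K ≠ ⊥) (hKfg : K.FG)
    (hfp : IsInternalFreeProductPair (MonoidHom.range φ) K)
    (Kn : ℤ → Subgroup (DescHNN φ hφ))
    (hKn : ∀ n : ℤ, Kn n = (K.map (HNNExtension.of : G →* DescHNN φ hφ)).map
      (MulAut.conj (HNNExtension.t ^ (-n))).toMonoidHom)
    (N M : Subgroup (DescHNN φ hφ))
    (hN : N = ⨆ n : ℤ, Kn n) (hM : M = ⨆ n : ℕ, Kn n) :
    ¬ N.FG ∧ ¬ M.FG := by
  have mem_Kn : ∀ (n : ℤ) (x : DescHNN φ hφ), x ∈ Kn n ↔ ∃ k ∈ K,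
      HNNExtension.t ^ (-n) * HNNExtension.of k * HNNExtension.t ^ n = x := by
    intro n x
    rw [hKn n]
    simp only [Subgroup.mem_map, exists_exists_and_eq_and, MulEquiv.coe_toMonoidHom,
      MulAut.conj_apply, zpow_neg, inv_inv]
  obtain ⟨k, hk, hk1⟩ := K.bot_or_exists_ne_one.resolve_left hK
  constructor
  · intro hfg
    let L : ℕ → Subgroup (DescHNN φ hφ) := fun n => ⨆ i : {i : ℤ // -(n : ℤ) ≤ i}, Kn i
    have hL : Monotone L := fun m n hmn =>
      iSup_le fun i => le_iSup_of_le ⟨i.1, by have := i.2; omega⟩ le_rfl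
    obtain ⟨n, hn⟩ := hfg.exists_eq_of_eq_iSup_of_monotone hL (by
      rw [hN]
      refine le_antisymm (iSup_le fun i => ?_) (iSup_le fun n => iSup_le fun i => le_iSup Kn i)
      exact le_iSup_of_le i.natAbs (le_iSup_of_le ⟨i, by omega⟩ le_rfl))
    have hle : L n ≤ (φ.range.map (HNNExtension.of : G →* DescHNN φ hφ)).map
        (MulAut.conj (HNNExtension.t ^ (n + 1 : ℤ))).toMonoidHom := by
      refine iSup_le fun ⟨i, hi⟩ x hx => ?_
      obtain ⟨c, -, rfl⟩ := (mem_Kn i x).1 hx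
      obtain ⟨m, hm⟩ := Int.eq_ofNat_of_zero_le (show 0 ≤ i + n by omega)
      obtain rfl : i = m - n := by omega
      refine ⟨_, ⟨φ^[m + 1] c, ⟨φ^[m] c, (Function.iterate_succ_apply' ..).symm⟩, rfl⟩, ?_⟩
      rw [DescHNN.of_iterate_s8]
      simp only [MulEquiv.coe_toMonoidHom, MulAut.conj_apply]
      push_cast
      group
    have hkN : HNNExtension.t ^ (n + 1 : ℤ) * HNNExtension.of k * HNNExtension.t ^ (-(n + 1 : ℤ))
        ∈ N := by
      rw [hN]
      refine le_iSup Kn (-(n + 1 : ℤ)) ((mem_Kn _ _).2 ⟨k, hk, ?_⟩)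
      rw [neg_neg]
    obtain ⟨_, ⟨h, hh, rfl⟩, he⟩ := hle (hn ▸ hkN)
    simp only [MulEquiv.coe_toMonoidHom, MulAut.conj_apply, zpow_neg, mul_left_inj,
      mul_right_inj] at he
    obtain rfl := HNNExtension.of_injective _ he
    exact hk1 (hfp.mem_of_mem_sup bot_le hh (Subgroup.mem_sup_left hk))
  · intro hfg
    obtain ⟨n, hn⟩ := hfg.exists_eq_of_eq_iSup_of_monotone
      (L := fun n => (iterateHull φ K n).map (HNNExtension.of : G →* DescHNN φ hφ))
      (fun _ _ h => Subgroup.map_mono (iterateHull_monotone φ K h)) (by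
        rw [hM]
        refine le_antisymm (iSup_le fun n x hx => ?_) (iSup_le fun n => ?_)
        · obtain ⟨c, hc, rfl⟩ := (mem_Kn _ _).1 hx
          rw [← DescHNN.of_iterate_s8]
          exact le_iSup (fun n => (iterateHull φ K n).map HNNExtension.of) (n + 1)
            (Subgroup.mem_map_of_mem _ (iterate_mem_iterateHull φ hc n))
        · rw [Subgroup.map_le_iff_le_comap]
          refine iterateHull_le (fun c hc m => ?_) n
          rw [Subgroup.mem_comap, DescHNN.of_iterate_s8]
          exact le_iSup (fun n : ℕ => Kn n) m ((mem_Kn _ _).2 ⟨c, hc, rfl⟩))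
    have hkM : (HNNExtension.of (φ^[n] k) : DescHNN φ hφ) ∈ M := by
      rw [hM]
      exact le_iSup (fun n : ℕ => Kn n) n
        ((mem_Kn _ _).2 ⟨k, hk, (DescHNN.of_iterate_s8 φ hφ k n).symm⟩)
    rw [hn, Subgroup.mem_map_iff_mem (HNNExtension.of_injective _)] at hkM
    exact hk1 (eq_one_of_iterate_mem_iterateHull hφ hfp hkM)
end
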